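/- arXiv:2308.10853 — 2 statements merged into one kernel-verified Lean document; each statement's English description precedes it below -/
import Mathlib

section
/- Let q be an odd prime power, d ≥ 2, and let B : F_q^d × F_q^d → F_q be a non-degenerate bilinear form. Let G be a distance graph on vertex set {1,…,n} with m edges, edge lengths λ_{i,j} ∈ F_q \ {0}, and maximum vertex degree t. Let A ⊆ F_q^d with |A| = α q^d and α ≥ 4 m q^{t − (d+1)/2}. Define the normalized count N_G(A) = q^{−nd} Σ_{x_1,…,x_n ∈ F_q^d} Π_{i=1}^n 1_A(x_i) · Π_{{i,j} edge of G, i<j} ( q · 1[B(x_i, x_j) = λ_{i,j}] ). Then | N_G(A) − α^n | ≤ 4 m α^{n−1} q^{t − (d+1)/2}. -/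
open Finset

namespace Aux5

/-- Summing over a coordinate again multiplies the sum by the size of the alphabet. -/
lemma sum_update {V X : Type} [Fintype V] [DecidableEq V] [Fintype X]
    (Φ : (V → X) → ℝ) (u : V) :
    ∑ x : V → X, ∑ a : X, Φ (Function.update x u a) = (Fintype.card X : ℝ) * ∑ x, Φ x := by
  have h1 : ∑ p : (V → X) × X, Φ (Function.update p.1 u p.2) = ∑ p : (V → X) × X, Φ p.1 := by
    refine Fintype.sum_equiv (Function.Involutive.toPerm
      (fun p : (V → X) × X => (Function.update p.1 u p.2, p.1 u)) ?_) _ _ ?_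
    · rintro ⟨x, a⟩
      simp
    · rintro ⟨x, a⟩
      rfl
  rw [Fintype.sum_prod_type, Fintype.sum_prod_type] at h1
  rw [h1]
  simp [Finset.mul_sum]

/-- The weight of a configuration. -/
noncomputable def P {V X : Type} (ind : X → ℝ) (w : V × V → X → X → ℝ)
    (S : Finset V) (E : Finset (V × V)) (x : V → X) : ℝ :=
  (∏ i ∈ S, ind (x i)) * ∏ e ∈ E, w e (x e.1) (x e.2)

lemma sum_base {V X : Type} [Fintype V] [DecidableEq V] [Fintype X]
    (ind : X → ℝ) (w : V × V → X → X → ℝ) (S : Finset V) (α : ℝ)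
    (hα : ∑ a, ind a = α * Fintype.card X) :
    ∑ x : V → X, P ind w S ∅ x = α ^ S.card * (Fintype.card X : ℝ) ^ Fintype.card V := by
  have h1 : ∀ x : V → X, P ind w S ∅ x = ∏ i, (if i ∈ S then ind (x i) else 1) := by
    intro x
    simp [P]
  simp_rw [h1]
  have h2 := Finset.prod_univ_sum (fun _ : V => (Finset.univ : Finset X))
    (fun i a => if i ∈ S then ind a else (1 : ℝ))
  rw [Fintype.piFinset_univ] at h2
  rw [← h2]
  have h3 : ∀ i : V, (∑ a : X, if i ∈ S then ind a else (1 : ℝ))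
      = (if i ∈ S then α else 1) * Fintype.card X := by
    intro i
    split_ifs <;> simp [hα]
  simp_rw [h3]
  rw [Finset.prod_mul_distrib]
  simp

/-- One-edge estimate. -/
lemma step {V X : Type} [Fintype V] [LinearOrder V] [Fintype X] [Nonempty X]
    (ind : X → ℝ) (hi0 : ∀ a, 0 ≤ ind a) (hi1 : ∀ a, ind a ≤ 1)
    (w : V × V → X → X → ℝ) (q c : ℝ) (hq : 1 ≤ q) (hc : 0 ≤ c) (t : ℕ)
    (hw0 : ∀ e a b, 0 ≤ w e a b) (hw1 : ∀ e a b, w e a b ≤ q)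
    (S : Finset V) (E : Finset (V × V)) (e : V × V) (he : e ∉ E)
    (hlt : ∀ e' ∈ insert e E, e'.1 < e'.2)
    (hS : ∀ e' ∈ insert e E, e'.1 ∈ S ∧ e'.2 ∈ S)
    (hdeg : ∀ v, ((insert e E).filter (fun e' => e'.1 = v ∨ e'.2 = v)).card ≤ t)
    (hK : ∀ f g : X → ℝ, (∀ a, 0 ≤ f a) → (∀ a, 0 ≤ g a) →
      |∑ a, ∑ b, f a * g b * (w e a b - 1)| ≤ c / 2 * (∑ a, f a ^ 2 + ∑ b, g b ^ 2)) :
    |∑ x, P ind w S (insert e E) x - ∑ x, P ind w S E x| ≤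
      c * q ^ (t - 1) / Fintype.card X / 2 *
       (∑ x, P ind w (S.erase e.2) (E.filter (fun e' => ¬ (e'.1 = e.2 ∨ e'.2 = e.2))) x +
        ∑ x, P ind w (S.erase e.1) (E.filter (fun e' => ¬ (e'.1 = e.1 ∨ e'.2 = e.1))) x) := by
  classical
  obtain ⟨u, v⟩ := e
  have huv : u < v := hlt _ (Finset.mem_insert_self _ _)
  have huvne : u ≠ v := huv.ne
  have huS : u ∈ S := (hS _ (Finset.mem_insert_self _ _)).1
  have hvS : v ∈ S := (hS _ (Finset.mem_insert_self _ _)).2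
  set N : ℝ := (Fintype.card X : ℝ) with hN
  have hNpos : 0 < N := by rw [hN]; exact_mod_cast Fintype.card_pos
  simp only
  set Eu := E.filter (fun e' => e'.1 = u ∨ e'.2 = u) with hEu
  set Ev := E.filter (fun e' => e'.1 = v ∨ e'.2 = v) with hEv
  set E0 := E.filter (fun e' => ¬ (e'.1 = u ∨ e'.2 = u) ∧ ¬ (e'.1 = v ∨ e'.2 = v)) with hE0
  set S0 := (S.erase u).erase v with hS0
  have hnoboth : ∀ e' ∈ E, (e'.1 = u ∨ e'.2 = u) → ¬ (e'.1 = v ∨ e'.2 = v) := by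
    rintro ⟨a, b⟩ hab h1 h2
    have h3 := hlt _ (Finset.mem_insert_of_mem hab)
    simp only at h1 h2 h3
    rcases h1 with rfl | rfl <;> rcases h2 with h2 | h2
    · exact huvne h2
    · subst h2; exact he hab
    · subst h2; exact lt_asymm h3 huv
    · exact huvne h2
  let Fm : (V → X) → ℝ := fun x => P ind w S0 E0 x
  let f : (V → X) → ℝ := fun x => ind (x u) * ∏ e ∈ Eu, w e (x e.1) (x e.2)
  let g : (V → X) → ℝ := fun x => ind (x v) * ∏ e ∈ Ev, w e (x e.1) (x e.2)
  have hPv : ∀ x, P ind w (S.erase v) (E.filter (fun e' => ¬ (e'.1 = v ∨ e'.2 = v))) x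
      = Fm x * f x := by
    intro x
    have h1 : S.erase v = insert u S0 := by
      ext i; simp only [hS0, Finset.mem_erase, Finset.mem_insert]; grind
    have h2 : E.filter (fun e' => ¬ (e'.1 = v ∨ e'.2 = v)) = E0 ∪ Eu := by
      ext i; simp only [hE0, hEu, Finset.mem_union, Finset.mem_filter]
      have := hnoboth i
      tauto
    have h3 : Disjoint E0 Eu := by
      rw [Finset.disjoint_left]; intro i; simp only [hE0, hEu, Finset.mem_filter]; tauto
    have h4 : u ∉ S0 := by simp [hS0]
    simp only [Fm, f, P]
    rw [h2, h1, Finset.prod_union h3, Finset.prod_insert h4]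
    ring
  have hPu : ∀ x, P ind w (S.erase u) (E.filter (fun e' => ¬ (e'.1 = u ∨ e'.2 = u))) x
      = Fm x * g x := by
    intro x
    have h1 : S.erase u = insert v S0 := by
      ext i; simp only [hS0, Finset.mem_erase, Finset.mem_insert]; grind
    have h2 : E.filter (fun e' => ¬ (e'.1 = u ∨ e'.2 = u)) = E0 ∪ Ev := by
      ext i; simp only [hE0, hEv, Finset.mem_union, Finset.mem_filter]
      have := hnoboth i
      tauto
    have h3 : Disjoint E0 Ev := by
      rw [Finset.disjoint_left]; intro i; simp only [hE0, hEv, Finset.mem_filter]; tauto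
    have h4 : v ∉ S0 := by simp [hS0]
    simp only [Fm, g, P]
    rw [h2, h1, Finset.prod_union h3, Finset.prod_insert h4]
    ring
  have hPE : ∀ x, P ind w S E x = Fm x * f x * g x := by
    intro x
    have h1 : S = insert v (S.erase v) := (Finset.insert_erase hvS).symm
    have h2 : E = E.filter (fun e' => ¬ (e'.1 = v ∨ e'.2 = v)) ∪ Ev := by
      ext i; simp only [hEv, Finset.mem_union, Finset.mem_filter]
      tauto
    have h3 : Disjoint (E.filter (fun e' => ¬ (e'.1 = v ∨ e'.2 = v))) Ev := by
      rw [Finset.disjoint_left]; intro i; simp only [hEv, Finset.mem_filter]; tauto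
    rw [← hPv]
    simp only [g, P]
    conv_lhs => rw [h2, h1]
    rw [Finset.prod_union h3, Finset.prod_insert (Finset.notMem_erase v S)]
    ring
  have hPE' : ∀ x, P ind w S (insert (u, v) E) x = Fm x * f x * g x * w (u, v) (x u) (x v) := by
    intro x
    rw [← hPE]
    simp only [P]
    rw [Finset.prod_insert he]
    ring
  have hprod : ∀ (E1 : Finset (V × V)) (x : V → X), 0 ≤ ∏ e ∈ E1, w e (x e.1) (x e.2) :=
    fun E1 x => Finset.prod_nonneg (fun _ _ => hw0 _ _ _)
  have hF0 : ∀ x, 0 ≤ Fm x := fun x =>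
    mul_nonneg (Finset.prod_nonneg (fun _ _ => hi0 _)) (hprod _ _)
  have hf0 : ∀ x, 0 ≤ f x := fun x => mul_nonneg (hi0 _) (hprod _ _)
  have hg0 : ∀ x, 0 ≤ g x := fun x => mul_nonneg (hi0 _) (hprod _ _)
  have hbd : ∀ (z y : V), (z = u ∨ z = v) → ∀ x : V → X,
      ind (x y) * ∏ e ∈ E.filter (fun e' => e'.1 = z ∨ e'.2 = z), w e (x e.1) (x e.2)
        ≤ q ^ (t - 1) := by
    intro z y hz x
    have hcard : (E.filter (fun e' => e'.1 = z ∨ e'.2 = z)).card ≤ t - 1 := by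
      have h := hdeg z
      rw [Finset.filter_insert, if_pos (by simp only; tauto), Finset.card_insert_of_notMem] at h
      · omega
      · intro h'; exact he (Finset.mem_filter.1 h').1
    calc ind (x y) * ∏ e ∈ E.filter (fun e' => e'.1 = z ∨ e'.2 = z), w e (x e.1) (x e.2)
        ≤ 1 * ∏ e ∈ E.filter (fun e' => e'.1 = z ∨ e'.2 = z), q := by
          apply mul_le_mul (hi1 _) _ (hprod _ _) zero_le_one
          exact Finset.prod_le_prod (fun _ _ => hw0 _ _ _) (fun _ _ => hw1 _ _ _)
      _ ≤ q ^ (t - 1) := by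
          rw [one_mul, Finset.prod_const]
          exact pow_le_pow_right₀ hq hcard
  have hf1 : ∀ x, f x ≤ q ^ (t - 1) := fun x => hbd u u (Or.inl rfl) x
  have hg1 : ∀ x, g x ≤ q ^ (t - 1) := fun x => hbd v v (Or.inr rfl) x
  -- independence of coordinates
  have hFu : ∀ x a, Fm (Function.update x u a) = Fm x := by
    intro x a
    simp only [Fm, P]
    congr 1
    · refine Finset.prod_congr rfl fun i hi => ?_
      have : i ≠ u := by rintro rfl; simp [hS0] at hi
      rw [Function.update_of_ne this]
    · refine Finset.prod_congr rfl fun i hi => ?_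
      have h := (Finset.mem_filter.1 hi).2.1
      push Not at h
      rw [Function.update_of_ne h.1, Function.update_of_ne h.2]
  have hFv : ∀ x a, Fm (Function.update x v a) = Fm x := by
    intro x a
    simp only [Fm, P]
    congr 1
    · refine Finset.prod_congr rfl fun i hi => ?_
      have : i ≠ v := by rintro rfl; simp [hS0] at hi
      rw [Function.update_of_ne this]
    · refine Finset.prod_congr rfl fun i hi => ?_
      have h := (Finset.mem_filter.1 hi).2.2
      push Not at h
      rw [Function.update_of_ne h.1, Function.update_of_ne h.2]
  have hfv : ∀ x a, f (Function.update x v a) = f x := by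
    intro x a
    simp only [f]
    rw [Function.update_of_ne huvne]
    congr 1
    refine Finset.prod_congr rfl fun i hi => ?_
    have hi' := Finset.mem_filter.1 hi
    have h := hnoboth i hi'.1 hi'.2
    push Not at h
    rw [Function.update_of_ne h.1, Function.update_of_ne h.2]
  have hgu : ∀ x a, g (Function.update x u a) = g x := by
    intro x a
    simp only [g]
    rw [Function.update_of_ne huvne.symm]
    congr 1
    refine Finset.prod_congr rfl fun i hi => ?_
    have hi' := Finset.mem_filter.1 hi
    have h : ¬ (i.1 = u ∨ i.2 = u) := fun h => hnoboth i hi'.1 h hi'.2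
    push Not at h
    rw [Function.update_of_ne h.1, Function.update_of_ne h.2]
  simp_rw [hPv, hPu, hPE, hPE']
  rw [← Finset.sum_sub_distrib]
  let Φ : (V → X) → ℝ := fun x => Fm x * f x * g x * (w (u, v) (x u) (x v) - 1)
  have hΦ : ∑ x, (Fm x * f x * g x * w (u, v) (x u) (x v) - Fm x * f x * g x) = ∑ x, Φ x :=
    Finset.sum_congr rfl fun x _ => by simp only [Φ]; ring
  rw [hΦ]
  have key : N * (N * ∑ x, Φ x) = ∑ x, Fm x * ∑ a, ∑ b,
      f (Function.update x u a) * g (Function.update x v b) * (w (u, v) a b - 1) := by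
    rw [hN, ← sum_update Φ v, ← sum_update _ u]
    refine Finset.sum_congr rfl fun x _ => ?_
    rw [Finset.mul_sum]
    refine Finset.sum_congr rfl fun a _ => ?_
    rw [Finset.mul_sum]
    refine Finset.sum_congr rfl fun b _ => ?_
    have hg' : g (Function.update (Function.update x u a) v b) = g (Function.update x v b) := by
      rw [Function.update_comm huvne, hgu]
    simp only [Φ]
    rw [hFv, hFu, hfv, hg', Function.update_of_ne huvne, Function.update_self,
      Function.update_self]
    ring
  have hsq : ∀ y M : ℝ, 0 ≤ y → y ≤ M → y ^ 2 ≤ M * y := by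
    intro y M h0 h1; nlinarith
  have bound : |N * (N * ∑ x, Φ x)| ≤ ∑ x, Fm x * (c / 2 * (q ^ (t - 1) *
      (∑ a, f (Function.update x u a) + ∑ b, g (Function.update x v b)))) := by
    rw [key]
    refine (Finset.abs_sum_le_sum_abs _ _).trans (Finset.sum_le_sum fun x _ => ?_)
    rw [abs_mul, abs_of_nonneg (hF0 x)]
    refine mul_le_mul_of_nonneg_left ?_ (hF0 x)
    refine (hK (fun a => f (Function.update x u a)) (fun b => g (Function.update x v b))
      (fun _ => hf0 _) (fun _ => hg0 _)).trans ?_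
    refine mul_le_mul_of_nonneg_left ?_ (by positivity)
    rw [mul_add, Finset.mul_sum, Finset.mul_sum]
    exact add_le_add (Finset.sum_le_sum fun a _ => hsq _ _ (hf0 _) (hf1 _))
      (Finset.sum_le_sum fun a _ => hsq _ _ (hg0 _) (hg1 _))
  have hs1 : ∑ x, Fm x * ∑ a, f (Function.update x u a) = N * ∑ x, Fm x * f x := by
    rw [hN, ← sum_update _ u]
    refine Finset.sum_congr rfl fun x _ => ?_
    rw [Finset.mul_sum]
    exact Finset.sum_congr rfl fun a _ => by rw [hFu]
  have hs2 : ∑ x, Fm x * ∑ a, g (Function.update x v a) = N * ∑ x, Fm x * g x := by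
    rw [hN, ← sum_update _ v]
    refine Finset.sum_congr rfl fun x _ => ?_
    rw [Finset.mul_sum]
    exact Finset.sum_congr rfl fun a _ => by rw [hFv]
  have hrhs : ∑ x, Fm x * (c / 2 * (q ^ (t - 1) *
      (∑ a, f (Function.update x u a) + ∑ b, g (Function.update x v b))))
      = c / 2 * q ^ (t - 1) * (N * ∑ x, Fm x * f x + N * ∑ x, Fm x * g x) := by
    rw [← hs1, ← hs2, ← Finset.sum_add_distrib, Finset.mul_sum]
    exact Finset.sum_congr rfl fun x _ => by ring
  rw [hrhs, abs_mul, abs_mul, abs_of_pos hNpos] at bound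
  have h5 : c * q ^ (t - 1) / N / 2 * (∑ x, Fm x * f x + ∑ x, Fm x * g x)
      = (c / 2 * q ^ (t - 1) * (N * ∑ x, Fm x * f x + N * ∑ x, Fm x * g x)) / (N * N) := by
    field_simp
  rw [h5, le_div_iff₀ (by positivity)]
  linarith

lemma main {V X : Type} [Fintype V] [LinearOrder V] [Fintype X] [Nonempty X]
    (ind : X → ℝ) (hi0 : ∀ a, 0 ≤ ind a) (hi1 : ∀ a, ind a ≤ 1)
    (w : V × V → X → X → ℝ) (q c : ℝ) (hq : 1 ≤ q) (hc : 0 ≤ c) (t : ℕ)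
    (hw0 : ∀ e a b, 0 ≤ w e a b) (hw1 : ∀ e a b, w e a b ≤ q) (α Q : ℝ)
    (hα : ∑ a, ind a = α * Fintype.card X) (hα0 : 0 ≤ α)
    (hQ : Q = c * q ^ (t - 1) / Fintype.card X) (k : ℕ) :
    ∀ (S : Finset V) (E : Finset (V × V)), E.card = k → 
    (∀ e' ∈ E, e'.1 < e'.2) →
    (∀ e' ∈ E, e'.1 ∈ S ∧ e'.2 ∈ S) →
    (∀ v, (E.filter (fun e' => e'.1 = v ∨ e'.2 = v)).card ≤ t) →
    (∀ e ∈ E, ∀ f g : X → ℝ, (∀ a, 0 ≤ f a) → (∀ a, 0 ≤ g a) →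
      |∑ a, ∑ b, f a * g b * (w e a b - 1)| ≤ c / 2 * (∑ a, f a ^ 2 + ∑ b, g b ^ 2)) →
    4 * (k : ℝ) * Q ≤ α →
    |∑ x, P ind w S E x - α ^ S.card * (Fintype.card X : ℝ) ^ Fintype.card V| ≤
      4 * k * α ^ (S.card - 1) * Q * (Fintype.card X : ℝ) ^ Fintype.card V := by
  induction k using Nat.strong_induction_on with
  | _ k ih =>
  intro S E hEk hlt hS hdeg hK hkQ
  have hNpos : (0 : ℝ) < Fintype.card X := by exact_mod_cast Fintype.card_pos
  have hQ0 : 0 ≤ Q := by rw [hQ]; positivity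
  rcases E.eq_empty_or_nonempty with rfl | ⟨e, he⟩
  · rw [sum_base ind w S α hα]
    simp only [Finset.card_empty] at hEk
    subst hEk
    simp
  obtain ⟨E', he', rfl⟩ : ∃ E', e ∉ E' ∧ insert e E' = E :=
    ⟨E.erase e, Finset.notMem_erase _ _, Finset.insert_erase he⟩
  rw [Finset.card_insert_of_notMem he'] at hEk
  set M : ℝ := (Fintype.card X : ℝ) ^ Fintype.card V with hM
  have hM0 : 0 < M := by positivity
  have hst := step ind hi0 hi1 w q c hq hc t hw0 hw1 S E' e he' hlt hS hdeg (hK e he)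
  rw [← hQ] at hst
  have heS := hS e he
  have hne : e.1 ≠ e.2 := (hlt e he).ne
  have hSc : 2 ≤ S.card := by
    have : ({e.1, e.2} : Finset V) ⊆ S := by
      intro i; simp only [Finset.mem_insert, Finset.mem_singleton]
      rintro (rfl | rfl)
      exacts [heS.1, heS.2]
    have h := Finset.card_le_card this
    rwa [Finset.card_pair hne] at h
  -- sub-estimate for vertex-deleted configurations
  have hmono : ∀ j : ℕ, j ≤ k → 4 * (j : ℝ) * Q ≤ α := by
    intro j hj
    refine le_trans ?_ hkQ
    have : (j : ℝ) ≤ k := by exact_mod_cast hj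
    gcongr
  have hsub : ∀ z ∈ S, ∑ x, P ind w (S.erase z)
      (E'.filter (fun e' => ¬ (e'.1 = z ∨ e'.2 = z))) x ≤ 2 * α ^ (S.card - 1) * M := by
    intro z hz
    have hss : E'.filter (fun e' => ¬ (e'.1 = z ∨ e'.2 = z)) ⊆ insert e E' :=
      (Finset.filter_subset _ _).trans (Finset.subset_insert _ _)
    have hcle : (E'.filter (fun e' => ¬ (e'.1 = z ∨ e'.2 = z))).card < k := by
      have := Finset.card_le_card (Finset.filter_subset (fun e' => ¬ (e'.1 = z ∨ e'.2 = z)) E')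
      omega
    have h := ih _ hcle (S.erase z) _ rfl (fun e' h' => hlt e' (hss h')) ?_ ?_
      (fun e' h' => hK e' (hss h')) (hmono _ hcle.le)
    · rw [Finset.card_erase_of_mem hz] at h
      have h2 := (abs_le.1 h).2
      have h3 := hmono _ hcle.le
      have h4 : α ^ (S.card - 1) = α * α ^ (S.card - 1 - 1) := by
        rw [← pow_succ']; congr 1; omega
      have h5 : 0 ≤ α ^ (S.card - 1 - 1) * M := by positivity
      have h6 := mul_le_mul_of_nonneg_right h3 h5
      rw [h4] at h2 ⊢
      linarith
    · intro e' h'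
      have h1 := hS e' (hss h')
      have h2 := (Finset.mem_filter.1 h').2
      push Not at h2
      exact ⟨Finset.mem_erase.2 ⟨h2.1, h1.1⟩, Finset.mem_erase.2 ⟨h2.2, h1.2⟩⟩
    · intro y
      exact (Finset.card_le_card (Finset.filter_subset_filter _ hss)).trans (hdeg y)
  have hmain := ih E'.card (by omega) S E' rfl
    (fun e' h' => hlt e' (Finset.mem_insert_of_mem h'))
    (fun e' h' => hS e' (Finset.mem_insert_of_mem h'))
    (fun y => (Finset.card_le_card (Finset.filter_subset_filter _
      (Finset.subset_insert _ _))).trans (hdeg y))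
    (fun e' h' => hK e' (Finset.mem_insert_of_mem h')) (hmono _ (by omega))
  have h1 := hsub e.1 heS.1
  have h2 := hsub e.2 heS.2
  have h3 := mul_le_mul_of_nonneg_left (add_le_add h2 h1) (by positivity : 0 ≤ Q / 2)
  have h4 := hst.trans h3
  have h5 : (k : ℝ) = E'.card + 1 := by exact_mod_cast hEk.symm
  have h6 : 0 ≤ α ^ (S.card - 1) * Q * M := by positivity
  rw [h5]
  rw [abs_le] at h4 hmain ⊢
  constructor <;> linarith [h4.1, h4.2, hmain.1, hmain.2]

section kernel

variable {F : Type} [Field F] [Fintype F] [DecidableEq F] {d : ℕ}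
  (B : (Fin d → F) →ₗ[F] (Fin d → F) →ₗ[F] F)

lemma count_one (hB : ∀ x, (∀ y, B x y = 0) → x = 0) (l : F) (a : Fin d → F) (ha : a ≠ 0) :
    (Fintype.card F : ℝ) * ((Finset.univ.filter (fun b => B a b = l)).card : ℝ)
      = Fintype.card (Fin d → F) := by
  obtain ⟨y, hy⟩ : ∃ y, B a y ≠ 0 := by
    by_contra h; push Not at h; exact ha (hB a h)
  have h : Fintype.card (F × {b // B a b = l}) = Fintype.card (Fin d → F) := by
    refine Fintype.card_congr
      ⟨fun p => p.2.1 + p.1 • y,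
       fun b => ((B a b - l) / B a y, ⟨b - ((B a b - l) / B a y) • y, ?_⟩), ?_, ?_⟩
    · simp [hy]
    · rintro ⟨m, b, hb⟩
      simp [hb, hy]
    · intro b
      simp
  rw [Fintype.card_prod, Fintype.card_subtype] at h
  exact_mod_cast h

lemma count_two (hB : ∀ x, (∀ y, B x y = 0) → x = 0) (l : F) (hl : l ≠ 0)
    (a a' : Fin d → F) (ha : a ≠ a') :
    (Fintype.card F : ℝ) ^ 2 * ((Finset.univ.filter (fun b => B a b = l ∧ B a' b = l)).card : ℝ)
      ≤ Fintype.card (Fin d → F) := by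
  rcases (Finset.univ.filter (fun b => B a b = l ∧ B a' b = l)).eq_empty_or_nonempty with h | ⟨b0, h⟩
  · rw [h]; simp
  obtain ⟨y, hy⟩ : ∃ y, B (a - a') y ≠ 0 := by
    by_contra h; push Not at h; exact ha (sub_eq_zero.1 (hB _ h))
  have hb0 := (Finset.mem_filter.1 h).2
  have h : Fintype.card ((F × F) × {b // B a b = l ∧ B a' b = l}) ≤ Fintype.card (Fin d → F) := by
    refine Fintype.card_le_of_injective (fun p => p.2.1 + p.1.1 • b0 + p.1.2 • y) ?_
    rintro ⟨⟨m, n⟩, b, hb⟩ ⟨⟨m', n'⟩, b', hb'⟩ hh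
    simp only at hh
    have h1 := congrArg (B (a - a')) hh
    have h2 := congrArg (B a) hh
    have hn : n = n' := by
      simp only [map_add, map_sub, map_smul, LinearMap.sub_apply, hb.1, hb.2, hb'.1, hb'.2,
        hb0.1, hb0.2, smul_eq_mul, sub_self, mul_zero, zero_add, add_zero] at h1
      rw [LinearMap.map_sub, LinearMap.sub_apply] at hy
      exact mul_right_cancel₀ hy h1
    subst hn
    have hm : m = m' := by
      simp only [map_add, map_smul, hb.1, hb'.1, hb0.1, smul_eq_mul] at h2
      have h3 : m * l = m' * l := by linear_combination h2
      exact mul_right_cancel₀ hl h3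
    subst hm
    have : b = b' := by
      simpa using hh
    subst this
    rfl
  rw [Fintype.card_prod, Fintype.card_prod, Fintype.card_subtype] at h
  rw [sq]
  exact_mod_cast h

lemma corr (hB : ∀ x, (∀ y, B x y = 0) → x = 0) (l : F) (hl : l ≠ 0) (a a' : Fin d → F) :
    ∑ b, ((if B a b = l then (Fintype.card F : ℝ) else 0) - 1) *
      ((if B a' b = l then (Fintype.card F : ℝ) else 0) - 1) ≤
    if a = a' then (Fintype.card F : ℝ) * Fintype.card (Fin d → F) else 0 := by
  set q : ℝ := (Fintype.card F : ℝ) with hq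
  set N : ℝ := (Fintype.card (Fin d → F) : ℝ) with hN
  have hq1 : 2 ≤ q := by
    rw [hq]; exact_mod_cast Fintype.one_lt_card (α := F)
  have hN0 : 0 < N := by rw [hN]; exact_mod_cast Fintype.card_pos
  have hexp : ∑ b, ((if B a b = l then q else 0) - 1) * ((if B a' b = l then q else 0) - 1)
      = q ^ 2 * ((Finset.univ.filter (fun b => B a b = l ∧ B a' b = l)).card : ℝ)
        - q * ((Finset.univ.filter (fun b => B a b = l)).card : ℝ)
        - q * ((Finset.univ.filter (fun b => B a' b = l)).card : ℝ) + N := by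
    have h : ∀ b, ((if B a b = l then q else 0) - 1) * ((if B a' b = l then q else 0) - 1)
        = q ^ 2 * (if B a b = l ∧ B a' b = l then 1 else 0) - q * (if B a b = l then 1 else 0)
          - q * (if B a' b = l then 1 else 0) + 1 := by
      intro b
      by_cases h1 : B a b = l <;> by_cases h2 : B a' b = l <;> simp [h1, h2] <;> ring
    simp_rw [h]
    rw [Finset.sum_add_distrib, Finset.sum_sub_distrib, Finset.sum_sub_distrib,
      ← Finset.mul_sum, ← Finset.mul_sum, ← Finset.mul_sum]
    simp [Finset.sum_boole, hN]
  rw [hexp]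
  have hz : (Finset.univ.filter (fun b => B 0 b = l)).card = 0 := by
    simp [Finset.filter_eq_empty_iff, hl.symm]
  split_ifs with h
  · subst h
    simp only [and_self]
    by_cases h0 : a = 0
    · subst h0
      rw [hz]
      push_cast
      nlinarith
    · have := count_one B hB l a h0
      rw [← hq, ← hN] at this
      rw [sq, mul_assoc, this]
      nlinarith
  · have h2 := count_two B hB l hl a a' h
    rw [← hq, ← hN] at h2
    by_cases h0 : a = 0
    · subst h0
      have h3 : (Finset.univ.filter (fun b => B 0 b = l ∧ B a' b = l)).card = 0 := by
        simp [Finset.filter_eq_empty_iff, hl.symm]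
      have := count_one B hB l a' (Ne.symm h)
      rw [← hq, ← hN] at this
      rw [h3, hz, this]; simp
    · have h4 := count_one B hB l a h0
      rw [← hq, ← hN] at h4
      by_cases h0' : a' = 0
      · subst h0'
        have h3 : (Finset.univ.filter (fun b => B a b = l ∧ B 0 b = l)).card = 0 := by
          simp [Finset.filter_eq_empty_iff, hl.symm]
        rw [h3, hz, h4]; simp
      · have h5 := count_one B hB l a' h0'
        rw [← hq, ← hN] at h5
        rw [h4, h5]; linarith

lemma kernel_bound (hB : ∀ x, (∀ y, B x y = 0) → x = 0) (l : F) (hl : l ≠ 0) (c : ℝ)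
    (hc : 0 < c) (hc2 : c ^ 2 = (Fintype.card F : ℝ) * Fintype.card (Fin d → F))
    (f g : (Fin d → F) → ℝ) (hf : ∀ a, 0 ≤ f a) :
    |∑ a, ∑ b, f a * g b * ((if B a b = l then (Fintype.card F : ℝ) else 0) - 1)|
      ≤ c / 2 * (∑ a, f a ^ 2 + ∑ b, g b ^ 2) := by
  set K : (Fin d → F) → (Fin d → F) → ℝ :=
    fun a b => (if B a b = l then (Fintype.card F : ℝ) else 0) - 1 with hK
  change |∑ a, ∑ b, f a * g b * K a b| ≤ _
  let h : (Fin d → F) → ℝ := fun b => ∑ a, f a * K a b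
  have h1 : ∑ a, ∑ b, f a * g b * K a b = ∑ b, g b * h b := by
    rw [Finset.sum_comm]
    refine Finset.sum_congr rfl fun b _ => ?_
    rw [Finset.mul_sum]
    exact Finset.sum_congr rfl fun a _ => by ring
  have h2 : ∑ b, h b ^ 2 ≤ c ^ 2 * ∑ a, f a ^ 2 := by
    have e1 : ∑ b, h b ^ 2 = ∑ a, ∑ a', f a * f a' * ∑ b, K a b * K a' b := by
      have e0 : ∀ b, h b ^ 2 = ∑ a, ∑ a', f a * K a b * (f a' * K a' b) := by
        intro b
        rw [sq]
        exact Finset.sum_mul_sum _ _ _ _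
      simp_rw [e0, Finset.mul_sum]
      rw [Finset.sum_comm]
      refine Finset.sum_congr rfl fun a _ => ?_
      rw [Finset.sum_comm]
      refine Finset.sum_congr rfl fun a' _ => ?_
      exact Finset.sum_congr rfl fun b _ => by ring
    rw [e1, Finset.mul_sum]
    refine Finset.sum_le_sum fun a _ => ?_
    calc ∑ a', f a * f a' * ∑ b, K a b * K a' b
        ≤ ∑ a', f a * f a' * (if a = a' then c ^ 2 else 0) := by
          refine Finset.sum_le_sum fun a' _ => ?_
          refine mul_le_mul_of_nonneg_left ?_ (mul_nonneg (hf _) (hf _))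
          rw [hc2]
          exact corr B hB l hl a a'
      _ ≤ c ^ 2 * f a ^ 2 := by
          simp only [mul_ite, mul_zero, Finset.sum_ite_eq, Finset.mem_univ, if_true]
          apply le_of_eq; ring
  rw [h1]
  have h3 : ∀ b, |g b * h b| ≤ c / 2 * g b ^ 2 + h b ^ 2 / (2 * c) := by
    intro b
    have e : c / 2 * g b ^ 2 + h b ^ 2 / (2 * c) = (c ^ 2 * g b ^ 2 + h b ^ 2) / (2 * c) := by
      field_simp
    rw [e, le_div_iff₀ (by positivity)]
    rcases abs_cases (g b * h b) with ⟨h4, _⟩ | ⟨h4, _⟩ <;> rw [h4]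
    · nlinarith [sq_nonneg (c * g b - h b)]
    · nlinarith [sq_nonneg (c * g b + h b)]
  calc |∑ b, g b * h b| ≤ ∑ b, |g b * h b| := Finset.abs_sum_le_sum_abs _ _
    _ ≤ ∑ b, (c / 2 * g b ^ 2 + h b ^ 2 / (2 * c)) := Finset.sum_le_sum fun b _ => h3 b
    _ = c / 2 * ∑ b, g b ^ 2 + (∑ b, h b ^ 2) / (2 * c) := by
        rw [Finset.sum_add_distrib, Finset.mul_sum, Finset.sum_div]
    _ ≤ c / 2 * ∑ b, g b ^ 2 + (c ^ 2 * ∑ a, f a ^ 2) / (2 * c) := by gcongr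
    _ = _ := by field_simp; ring

end kernel

end Aux5

/-- Asymptotic count of isometric copies of a distance graph,
bilinear form case. -/
theorem stmt5 (q d n m t : ℕ) (hd : 2 ≤ d) (hn : 0 < n)
    (F : Type) [Field F] [Fintype F] [DecidableEq F]
    (hq : Fintype.card F = q) (hodd : Odd q)
    (B : (Fin d → F) →ₗ[F] (Fin d → F) →ₗ[F] F)
    (hB : ∀ x, (∀ y, B x y = 0) → x = 0)
    (G : SimpleGraph (Fin n)) [DecidableRel G.Adj]
    (hm : G.edgeFinset.card = m)
    (hdeg : ∀ v, G.degree v ≤ t)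
    (lam : Fin n → Fin n → F)
    (hsymm : ∀ i j, lam i j = lam j i)
    (hlam : ∀ i j, G.Adj i j → lam i j ≠ 0)
    (A : Finset (Fin d → F)) (α : ℝ)
    (hcard : (A.card : ℝ) = α * (q : ℝ) ^ d)
    (hα : α ≥ 4 * (m : ℝ) * (q : ℝ) ^ ((t : ℝ) - ((d : ℝ) + 1) / 2)) :
    |(q : ℝ) ^ (-((n : ℝ) * (d : ℝ))) *
        (∑ x : Fin n → (Fin d → F),
          (∏ i, if x i ∈ A then (1 : ℝ) else 0) *
            ∏ i, ∏ j, if i < j ∧ G.Adj i j then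
              (if B (x i) (x j) = lam i j then (q : ℝ) else 0) else 1) -
        α ^ n| ≤
      4 * (m : ℝ) * α ^ (n - 1) * (q : ℝ) ^ ((t : ℝ) - ((d : ℝ) + 1) / 2) := by
  classical
  have hq2 : 2 ≤ q := by rw [← hq]; exact Fintype.one_lt_card (α := F)
  have hqpos : (0 : ℝ) < q := by exact_mod_cast (by omega : 0 < q)
  have hq1 : (1 : ℝ) ≤ q := by exact_mod_cast (by omega : 1 ≤ q)
  set Q : ℝ := (q : ℝ) ^ ((t : ℝ) - ((d : ℝ) + 1) / 2) with hQdef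
  have hQ0 : 0 < Q := Real.rpow_pos_of_pos hqpos _
  have hα0 : 0 ≤ α := le_trans (by positivity) hα
  have hcardX : (Fintype.card (Fin d → F) : ℝ) = (q : ℝ) ^ d := by simp [hq]
  let ind : (Fin d → F) → ℝ := fun a => if a ∈ A then 1 else 0
  let w : Fin n × Fin n → (Fin d → F) → (Fin d → F) → ℝ :=
    fun e a b => if B a b = lam e.1 e.2 then (q : ℝ) else 0
  let E : Finset (Fin n × Fin n) := Finset.univ.filter (fun e => e.1 < e.2 ∧ G.Adj e.1 e.2)
  let c : ℝ := (q : ℝ) ^ (((d : ℝ) + 1) / 2)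
  have hc0 : 0 < c := Real.rpow_pos_of_pos hqpos _
  have hc2 : c ^ 2 = (Fintype.card F : ℝ) * Fintype.card (Fin d → F) := by
    rw [hcardX, hq]
    simp only [c]
    rw [← Real.rpow_natCast, ← Real.rpow_mul hqpos.le, ← pow_succ', ← Real.rpow_natCast]
    congr 1
    push_cast
    ring
  have hEmem : ∀ e ∈ E, e.1 < e.2 ∧ G.Adj e.1 e.2 := fun e he => (Finset.mem_filter.1 he).2
  have hEm : E.card ≤ m := by
    rw [← hm]
    refine Finset.card_le_card_of_injOn (fun e => s(e.1, e.2)) ?_ ?_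
    · intro e he
      simpa using (hEmem e he).2
    · rintro ⟨a, b⟩ h1 ⟨a', b'⟩ h2 h
      have h1' := (hEmem _ h1).1
      have h2' := (hEmem _ h2).1
      simp only [Sym2.eq_iff] at h h1' h2'
      rcases h with ⟨rfl, rfl⟩ | ⟨rfl, rfl⟩
      · rfl
      · exact absurd h1' (lt_asymm h2')
  have hEdeg : ∀ v, (E.filter (fun e' => e'.1 = v ∨ e'.2 = v)).card ≤ t := by
    intro v
    refine le_trans ?_ (hdeg v)
    rw [← SimpleGraph.card_neighborFinset_eq_degree]
    refine Finset.card_le_card_of_injOn (fun e => if e.1 = v then e.2 else e.1) ?_ ?_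
    · rintro ⟨a, b⟩ he
      have he' := Finset.mem_filter.1 he
      have h := (hEmem _ he'.1).2
      have h' := he'.2
      simp only at h h'
      simp only [Finset.mem_coe, SimpleGraph.mem_neighborFinset]
      split_ifs with h1
      · rw [← h1]; exact h
      · rcases h' with h' | h'
        · exact absurd h' h1
        · rw [← h']; exact h.symm
    · rintro ⟨a, b⟩ h1 ⟨a', b'⟩ h2 h
      have k1 := Finset.mem_filter.1 h1
      have k2 := Finset.mem_filter.1 h2
      have l1 := (hEmem _ k1.1).1
      have l2 := (hEmem _ k2.1).1
      have j1 := k1.2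
      have j2 := k2.2
      simp only at h l1 l2 j1 j2
      ext <;> simp only <;> grind
  have hαs : ∑ a, ind a = α * Fintype.card (Fin d → F) := by
    rw [hcardX, ← hcard]; simp [ind]
  -- the trivial case of no edges has to be separated, as then t may vanish
  have hfinal : |∑ x, Aux5.P ind w Finset.univ E x - α ^ n * ((q : ℝ) ^ d) ^ n| ≤
      4 * m * α ^ (n - 1) * Q * ((q : ℝ) ^ d) ^ n := by
    rcases E.eq_empty_or_nonempty with hE | ⟨e0, he0⟩
    · rw [hE, Aux5.sum_base ind w Finset.univ α hαs, hcardX]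
      simp only [Finset.card_univ, Fintype.card_fin, sub_self, abs_zero]
      positivity
    have ht : 1 ≤ t := by
      refine le_trans ?_ (hEdeg e0.1)
      exact Finset.card_pos.2 ⟨e0, Finset.mem_filter.2 ⟨he0, Or.inl rfl⟩⟩
    have hQe : Q = c * (q : ℝ) ^ (t - 1) / Fintype.card (Fin d → F) := by
      rw [hcardX, eq_div_iff (by positivity)]
      simp only [Q, c]
      rw [← Real.rpow_natCast, ← Real.rpow_natCast, ← Real.rpow_add hqpos, ← Real.rpow_add hqpos]
      congr 1
      rw [Nat.cast_sub ht]
      push_cast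
      ring
    have hEm' : (E.card : ℝ) ≤ m := by exact_mod_cast hEm
    have h := Aux5.main ind (fun a => by simp only [ind]; split_ifs <;> norm_num)
      (fun a => by simp only [ind]; split_ifs <;> norm_num) w q c hq1 hc0.le t
      (fun e a b => by simp only [w]; split_ifs <;> linarith)
      (fun e a b => by simp only [w]; split_ifs <;> linarith)
      α Q hαs hα0 hQe E.card Finset.univ E rfl (fun e he => (hEmem e he).1)
      (fun e he => ⟨Finset.mem_univ _, Finset.mem_univ _⟩) hEdeg
      (fun e he f g hf hg => by
        have := Aux5.kernel_bound B hB (lam e.1 e.2) (hlam _ _ (hEmem e he).2) c hc0 hc2 f g hf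
        rw [hq] at this
        exact this)
      (le_trans (by gcongr) hα)
    rw [hcardX] at h
    simp only [Finset.card_univ, Fintype.card_fin] at h
    refine h.trans ?_
    gcongr
  have hP : ∀ x : Fin n → (Fin d → F), (∏ i, if x i ∈ A then (1 : ℝ) else 0) *
            (∏ i, ∏ j, if i < j ∧ G.Adj i j then
              (if B (x i) (x j) = lam i j then (q : ℝ) else 0) else 1)
      = Aux5.P ind w Finset.univ E x := by
    intro x
    simp only [Aux5.P, ind, w, E]
    rw [Finset.prod_filter, Fintype.prod_prod_type]
  simp_rw [hP]
  have hM : (q : ℝ) ^ (-((n : ℝ) * (d : ℝ))) = (((q : ℝ) ^ d) ^ n)⁻¹ := by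
    rw [Real.rpow_neg hqpos.le, ← pow_mul, ← Real.rpow_natCast]
    push_cast
    rw [mul_comm]
  rw [hM]
  set M : ℝ := ((q : ℝ) ^ d) ^ n with hMd
  have hM0 : 0 < M := by positivity
  have heq : M⁻¹ * (∑ x, Aux5.P ind w Finset.univ E x) - α ^ n
      = M⁻¹ * (∑ x, Aux5.P ind w Finset.univ E x - α ^ n * M) := by
    field_simp
  rw [heq, abs_mul, abs_of_pos (inv_pos.2 hM0), inv_mul_le_iff₀ hM0]
  linarith
end

section
/- Let q be an odd prime power, d ≥ 2, and let Q be a non-degenerate quadratic form on F_q^d. Let G be a distance graph on vertex set {1,…,n} with m edges, edge lengths λ_{i,j} ∈ F_q \ {0}, and maximum vertex degree t. Let A ⊆ F_q^d with |A| = α q^d and α ≥ 4 m q^{t − (d+1)/2}. Define the normalized count N_G(A) = q^{−nd} Σ_{x_1,…,x_n ∈ F_q^d} Π_{i=1}^n 1_A(x_i) · Π_{{i,j} edge of G, i<j} ( q · 1[Q(x_i − x_j) = λ_{i,j}] ). Then | N_G(A) − α^n | ≤ 4 m α^{n−1} q^{t − (d+1)/2}. -/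
open Finset

section StepanovCore
open Polynomial

/-- Span of the monomials of total degree at most `w`. -/
def monoSpan (F : Type*) {A : Type*} [Field F] [CommRing A] [Algebra F A] (x z : A) (w : ℕ) :
    Submodule F A := Submodule.span F {y | ∃ m k : ℕ, m + k ≤ w ∧ y = x ^ m * z ^ k}

variable {F A : Type*} [Field F] [CommRing A] [Algebra F A]

lemma monoSpan_mono (x z : A) {w v : ℕ} (h : w ≤ v) : monoSpan F x z w ≤ monoSpan F x z v := by
  apply Submodule.span_mono
  rintro y ⟨m, k, hmk, rfl⟩
  exact ⟨m, k, hmk.trans h, rfl⟩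

lemma monoSpan_mul {x z : A} {w v : ℕ} {y y' : A} (h : y ∈ monoSpan F x z w)
    (h' : y' ∈ monoSpan F x z v) : y * y' ∈ monoSpan F x z (w + v) := by
  have h1 := Submodule.mul_mem_mul h h'
  unfold monoSpan at h1
  rw [Submodule.span_mul_span] at h1
  refine Submodule.span_mono ?_ h1
  rintro _ ⟨_, ⟨m, k, hmk, rfl⟩, _, ⟨m', k', hmk', rfl⟩, rfl⟩
  exact ⟨m + m', k + k', by omega, by ring⟩

lemma monoSpan_mem (x z : A) {w m k : ℕ} (h : m + k ≤ w) : x ^ m * z ^ k ∈ monoSpan F x z w :=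
  Submodule.subset_span ⟨m, k, h, rfl⟩

lemma monoSpan_pow {x z : A} {w : ℕ} {y : A} (h : y ∈ monoSpan F x z w) (i : ℕ) :
    y ^ i ∈ monoSpan F x z (i * w) := by
  induction i with
  | zero => simpa using monoSpan_mem (F := F) x z (w := 0 * w) (m := 0) (k := 0) (by omega)
  | succ i ih =>
    rw [pow_succ, Nat.succ_mul]
    exact monoSpan_mul ih h

lemma monoSpan_le_range {x z : A} {l : ℕ} (hl : 0 < l) (h : x ^ l = z ^ l) (w : ℕ) :
    monoSpan F x z w ≤ Submodule.span F
      (Set.range fun p : Fin l × Fin (w + 1) => x ^ (p.1 : ℕ) * z ^ (p.2 : ℕ)) := by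
  refine Submodule.span_mono ?_
  rintro y ⟨m, k, hmk, rfl⟩
  have h1 := Nat.div_add_mod m l
  refine ⟨(⟨m % l, Nat.mod_lt _ hl⟩, ⟨k + l * (m / l), by omega⟩), ?_⟩
  simp only
  conv_rhs => rw [← h1, pow_add, pow_mul, h, ← pow_mul]
  ring

lemma exists_rel_monoSpan {x z : A} {l : ℕ} (hl : 0 < l) (h : x ^ l = z ^ l) (w M : ℕ)
    (hM : l * (w + 1) < M) (v : Fin M → A) (hv : ∀ i, v i ∈ monoSpan F x z w) :
    ∃ c : Fin M → F, c ≠ 0 ∧ ∑ i, c i • v i = 0 := by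
  classical
  set S := Submodule.span F
      (Set.range fun p : Fin l × Fin (w + 1) => x ^ (p.1 : ℕ) * z ^ (p.2 : ℕ)) with hS
  have hfin : Module.finrank F S ≤ l * (w + 1) := by
    have := finrank_range_le_card (R := F)
      (fun p : Fin l × Fin (w + 1) => x ^ (p.1 : ℕ) * z ^ (p.2 : ℕ))
    simpa [Set.finrank] using this
  have : FiniteDimensional F S := FiniteDimensional.span_of_finite F (Set.finite_range _)
  by_contra hcon
  push Not at hcon
  have hli : LinearIndependent F (fun i => (⟨v i, monoSpan_le_range hl h w (hv i)⟩ : S)) := by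
    rw [Fintype.linearIndependent_iff]
    intro g hg
    by_contra hne
    push Not at hne
    obtain ⟨i, hi⟩ := hne
    refine hcon g (fun h0 => hi (by simp [h0])) ?_
    have := congrArg (Subtype.val) hg
    simpa using this
  have := hli.fintype_card_le_finrank
  simp at this
  omega

lemma exists_top_degree {M : ℕ} (k : ℕ) (p : Fin M → F[X]) (hp : ∀ i, (p i).natDegree = i + k)
    (hp0 : ∀ i, p i ≠ 0) (c : Fin M → F) (hc : c ≠ 0) : ∑ i, c i • p i ≠ 0 := by
  classical
  have hne : (univ.filter fun i => c i ≠ 0).Nonempty := by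
    obtain ⟨i, hi⟩ := Function.ne_iff.1 hc
    exact ⟨i, by simpa using hi⟩
  obtain ⟨i, hi, hmax⟩ := Finset.exists_max_image _ (fun i : Fin M => i) hne
  simp only [mem_filter, mem_univ, true_and] at hi hmax
  intro h
  have h1 := congrArg (fun P : F[X] => P.coeff (i + k)) h
  simp only [finsetSum_coeff, coeff_smul, coeff_zero, smul_eq_mul] at h1
  rw [Finset.sum_eq_single i] at h1
  · rw [← hp i, coeff_natDegree] at h1
    exact mul_ne_zero hi (leadingCoeff_ne_zero.2 (hp0 i)) h1
  · intro j _ hji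
    by_cases hcj : c j = 0
    · simp [hcj]
    · have := hmax j hcj
      have hlt : j < i := lt_of_le_of_ne this hji
      rw [coeff_eq_zero_of_natDegree_lt, mul_zero]
      rw [hp j]
      have : (j : ℕ) < i := hlt
      omega
  · simp

/-- The polynomial `X ^ D * Σ_{k<n} (a X^{q^k} + b X^{-q^k})` -/
noncomputable def stP (a b : F) (q D n : ℕ) : F[X] :=
  ∑ k ∈ range n, (C a * X ^ (D + q ^ k) + C b * X ^ (D - q ^ k))

lemma stP_natDegree (a b : F) (ha : a ≠ 0) (q n : ℕ) (hq : 2 ≤ q) :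
    (stP a b q (q ^ n) (n + 1)).natDegree = 2 * q ^ n := by
  unfold stP
  have hpos : ∀ k, 0 < q ^ k := fun k => by positivity
  have hle : (∑ k ∈ range n, (C a * X ^ (q ^ n + q ^ k) + C b * X ^ (q ^ n - q ^ k))
      + C b * X ^ (q ^ n - q ^ n) : F[X]).degree < ((2 * q ^ n : ℕ) : WithBot ℕ) := by
    rw [← mem_degreeLT]
    refine Submodule.add_mem _ (Submodule.sum_mem _ fun k hk => Submodule.add_mem _ ?_ ?_) ?_ <;>
      rw [mem_degreeLT] <;> refine lt_of_le_of_lt (degree_C_mul_X_pow_le _ _) ?_ <;>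
      rw [Nat.cast_lt]
    · have : q ^ k < q ^ n := Nat.pow_lt_pow_right (by omega) (mem_range.1 hk)
      omega
    · have := hpos n
      omega
    · have := hpos n
      omega
  rw [sum_range_succ, add_comm (C a * X ^ (q ^ n + q ^ n)), ← add_assoc]
  apply natDegree_eq_of_degree_eq_some
  rw [degree_add_eq_right_of_degree_lt]
  · rw [degree_C_mul_X_pow _ ha, two_mul]
  · rw [degree_C_mul_X_pow _ ha, ← two_mul]
    exact hle

theorem stepanov_core (q s : ℕ) (hq : 3 ≤ q)
    (a b c : F) (ha : a ≠ 0) (x x' z z' : A) (hx : x * x' = 1) (hz : z * z' = 1)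
    (hL : x ^ (q ^ (s + 1)) = z ^ (q ^ (s + 1))) (hQ : z ^ (q ^ (2 * s + 2)) = z)
    (hc : ∑ k ∈ range (2 * s + 2), (a • z ^ (q ^ k) + b • z' ^ (q ^ k)) = algebraMap F A c) :
    ∃ R : F[X], R ≠ 0 ∧ R.natDegree < (q ^ s + 9) * q ^ (2 * s + 2) ∧ aeval x R = 0 := by
  classical
  set D := q ^ (2 * s + 1) with hD
  set J := q ^ s + 8 with hJ
  set E := q ^ s with hE
  have hDpos : 0 < D := by positivity
  have hEpos : 0 < E := by positivity
  have hL1 : q ^ (s + 1) = q * E := by rw [hE]; ring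
  have hQ1 : q ^ (2 * s + 2) = q * D := by rw [hD]; ring
  have hD1 : D = q * E * E := by rw [hD, hE]; ring
  have hinv : ∀ k, x ^ k * x' ^ k = 1 := fun k => by rw [← mul_pow, hx, one_pow]
  have hinvz : ∀ k, z ^ k * z' ^ k = 1 := fun k => by rw [← mul_pow, hz, one_pow]
  set P := stP a b q D (2 * s + 2) with hP
  have hPdeg : P.natDegree = 2 * D := stP_natDegree a b ha q (2 * s + 1) (by omega)
  have hP0 : P ≠ 0 := by
    intro h
    rw [h] at hPdeg
    simp at hPdeg
    omega
  -- g
  set g : A → A → ℕ → A := fun y y' n => ∑ k ∈ range n, (a • y ^ (q ^ k) + b • y' ^ (q ^ k)) with hg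
  have hx'L : x' ^ (q ^ (s + 1)) = z' ^ (q ^ (s + 1)) := by
    calc x' ^ (q ^ (s + 1)) = x' ^ (q ^ (s + 1)) * (z ^ (q ^ (s + 1)) * z' ^ (q ^ (s + 1))) := by
          rw [hinvz, mul_one]
      _ = (x ^ (q ^ (s + 1)) * x' ^ (q ^ (s + 1))) * z' ^ (q ^ (s + 1)) := by rw [← hL]; ring
      _ = _ := by rw [hinv, one_mul]
  have hgx : g x x' (2 * s + 2) = g x x' (s + 1) - g z z' (s + 1) + algebraMap F A c := by
    rw [← hc]
    simp only [hg]
    rw [show 2 * s + 2 = (s + 1) + (s + 1) by ring, sum_range_add, sum_range_add _ (s + 1) (s + 1)]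
    have : ∀ k, a • x ^ q ^ (s + 1 + k) + b • x' ^ q ^ (s + 1 + k)
        = a • z ^ q ^ (s + 1 + k) + b • z' ^ q ^ (s + 1 + k) := by
      intro k
      rw [pow_add q, pow_mul, pow_mul, hL, hx'L, ← pow_mul, ← pow_mul]
    simp only [this]
    ring
  have hPx : aeval x P = x ^ D * g x x' (2 * s + 2) := by
    simp only [hP, stP, hg, map_sum, map_add, map_mul, aeval_C, map_pow, aeval_X, mul_sum]
    refine sum_congr rfl fun k hk => ?_
    have hk' : q ^ k ≤ D := Nat.pow_le_pow_right (by omega) (by have := mem_range.1 hk; omega)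
    have : x ^ D * x' ^ q ^ k = x ^ (D - q ^ k) := by
      conv_lhs => rw [← Nat.sub_add_cancel hk', pow_add, mul_assoc, hinv, mul_one]
    rw [mul_add, Algebra.smul_def, Algebra.smul_def, ← this]
    ring
  -- family
  set p : ℕ → F[X] := fun N => X ^ (N % D) * X ^ (N / D / q * (q * D)) *
    X ^ ((q - 1 - N / D % q) * D) * P ^ (N / D % q) with hp
  have hpdeg : ∀ N, (p N).natDegree = N + (q - 1) * D := by
    intro N
    have h1 : N / D % q < q := Nat.mod_lt _ (by omega)
    have h2 := Nat.div_add_mod N D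
    have h3 := Nat.div_add_mod (N / D) q
    simp only [hp]
    rw [natDegree_mul (by simp) (by simp [hP0]), natDegree_mul (by simp) (by simp),
      natDegree_mul (by simp) (by simp), natDegree_pow P, hPdeg]
    simp only [natDegree_X_pow]
    generalize N / D % q = i at *
    generalize N / D / q = j at *
    obtain ⟨r, rfl⟩ : ∃ r, q = i + 1 + r := ⟨q - (i + 1), by omega⟩
    rw [show i + 1 + r - 1 - i = r by omega, show i + 1 + r - 1 = i + r by omega]
    conv_rhs => rw [← h2, ← h3]
    ring
  have hpne : ∀ N, p N ≠ 0 := by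
    intro N
    simp [hp, hP0]
  set u : A := x' ^ ((q - 1) * D) * (x * z) ^ ((q - 1) * E) with hu
  set W := D + J + 3 * (q * E) with hW
  have hmem : ∀ N, N < J * (q * D) → u * aeval x (p N) ∈ monoSpan F x z W := by
    intro N hN
    have h1 : N / D % q < q := Nat.mod_lt _ (by omega)
    have h2 : N % D < D := Nat.mod_lt _ hDpos
    have h3 : N / D / q < J := by
      rw [Nat.div_div_eq_div_mul, Nat.div_lt_iff_lt_mul (by positivity)]
      rwa [mul_comm D q]
    have heq : u * aeval x (p N) = (x ^ (N % D) * z ^ (N / D / q)) *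
        ((x ^ E * z ^ E * g x x' (2 * s + 2)) ^ (N / D % q) *
          (x ^ ((q - 1 - N / D % q) * E) * z ^ ((q - 1 - N / D % q) * E))) := by
      simp only [hp, hu, map_mul, map_pow, aeval_X, hPx]
      generalize N / D % q = i at *
      generalize N / D / q = j at *
      have hxQ : x ^ (j * (q * D)) = z ^ j := by
        have : q * D = q ^ (s + 1) * q ^ (s + 1) := by rw [hL1, hD1]; ring
        rw [mul_comm j, pow_mul, this, pow_mul x, hL, ← pow_mul z, ← this, ← hQ1, hQ]
      obtain ⟨r, rfl⟩ : ∃ r, q = i + 1 + r := ⟨q - (i + 1), by omega⟩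
      rw [hxQ, show i + 1 + r - 1 - i = r by omega, show i + 1 + r - 1 = i + r by omega]
      have := hinv ((i + r) * D)
      calc _ = (x ^ ((i + r) * D) * x' ^ ((i + r) * D)) * ((x * z) ^ ((i + r) * E) *
            (x ^ (N % D) * z ^ j * g x x' (2 * s + 2) ^ i)) := by ring
        _ = _ := by rw [this]; ring
    rw [heq]
    have hb : x ^ E * z ^ E * g x x' (2 * s + 2) ∈ monoSpan F x z (3 * E) := by
      have hkE : ∀ k ∈ range (s + 1), q ^ k ≤ E := fun k hk =>
        Nat.pow_le_pow_right (by omega) (by have := mem_range.1 hk; omega)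
      rw [hgx, mul_add, mul_sub]
      simp only [hg, mul_sum]
      refine Submodule.add_mem _ (Submodule.sub_mem _ (Submodule.sum_mem _ fun k hk => ?_)
        (Submodule.sum_mem _ fun k hk => ?_)) ?_
      · have h4 := hkE k hk
        have : x ^ E * x' ^ q ^ k = x ^ (E - q ^ k) := by
          conv_lhs => rw [← Nat.sub_add_cancel h4, pow_add, mul_assoc, hinv, mul_one]
        rw [mul_add, mul_smul_comm, mul_smul_comm]
        refine Submodule.add_mem _ (Submodule.smul_mem _ _ ?_) (Submodule.smul_mem _ _ ?_)
        · rw [show x ^ E * z ^ E * x ^ q ^ k = x ^ (E + q ^ k) * z ^ E by ring]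
          exact monoSpan_mem _ _ (by omega)
        · rw [show x ^ E * z ^ E * x' ^ q ^ k = (x ^ E * x' ^ q ^ k) * z ^ E by ring, this]
          exact monoSpan_mem _ _ (by omega)
      · have h4 := hkE k hk
        have : z ^ E * z' ^ q ^ k = z ^ (E - q ^ k) := by
          conv_lhs => rw [← Nat.sub_add_cancel h4, pow_add, mul_assoc, hinvz, mul_one]
        rw [mul_add, mul_smul_comm, mul_smul_comm]
        refine Submodule.add_mem _ (Submodule.smul_mem _ _ ?_) (Submodule.smul_mem _ _ ?_)
        · rw [show x ^ E * z ^ E * z ^ q ^ k = x ^ E * z ^ (E + q ^ k) by ring]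
          exact monoSpan_mem _ _ (by omega)
        · rw [show x ^ E * z ^ E * z' ^ q ^ k = x ^ E * (z ^ E * z' ^ q ^ k) by ring, this]
          exact monoSpan_mem _ _ (by omega)
      · rw [mul_comm _ (algebraMap F A c), ← Algebra.smul_def]
        exact Submodule.smul_mem _ _ (monoSpan_mem _ _ (by omega))
    refine monoSpan_mono _ _ ?_ (monoSpan_mul (monoSpan_mem x z (le_refl _))
      (monoSpan_mul (monoSpan_pow hb _) (monoSpan_mem x z (le_refl _))))
    generalize N / D % q = i at *
    generalize N / D / q = j at *
    obtain ⟨r, rfl⟩ : ∃ r, q = i + 1 + r := ⟨q - (i + 1), by omega⟩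
    rw [show i + 1 + r - 1 - i = r by omega, hW]
    nlinarith
  have hcount : (q * E) * (W + 1) < J * (q * D) := by
    rw [hW, hJ, hD1]
    have : E + 9 + 3 * (q * E) < 8 * (q * E) := by nlinarith
    nlinarith [mul_pos (show 0 < q by omega) hEpos]
  obtain ⟨cf, hcf, hrel⟩ := exists_rel_monoSpan (F := F) (x := x) (z := z) (l := q * E)
    (by positivity) (by rw [← hL1]; exact hL) W (J * (q * D)) hcount
    (fun N => u * aeval x (p N)) (fun N => hmem N N.2)
  refine ⟨∑ N, cf N • p N, ?_, ?_, ?_⟩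
  · exact exists_top_degree ((q - 1) * D) (fun N : Fin (J * (q * D)) => p N)
      (fun N => hpdeg N) (fun N => hpne N) cf hcf
  · rw [hQ1]
    have hlt : (q ^ s + 9) * (q * D) = J * (q * D) + q * D := by rw [hJ]; ring
    have hqD : (q - 1) * D + D = q * D := by
      obtain ⟨r, rfl⟩ : ∃ r, q = r + 1 := ⟨q - 1, by omega⟩
      simp; ring
    have hle : (∑ N, cf N • p N : F[X]).natDegree ≤ J * (q * D) + (q - 1) * D := by
      refine natDegree_sum_le_of_forall_le _ _ fun N _ => ?_
      refine (natDegree_smul_le _ _).trans ?_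
      rw [hpdeg]
      have := N.2
      omega
    rw [← hE] at hlt
    omega
  · have h1 : u * aeval x (∑ N, cf N • p N) = 0 := by
      rw [← hrel, map_sum, mul_sum]
      refine sum_congr rfl fun N _ => ?_
      rw [map_smul, mul_smul_comm]
    have hunit : IsUnit u := by
      have hx1 : IsUnit x := IsUnit.of_mul_eq_one _ hx
      have hx2 : IsUnit x' := IsUnit.of_mul_eq_one _ (by rw [mul_comm]; exact hx)
      have hz1 : IsUnit z := IsUnit.of_mul_eq_one _ hz
      exact (hx2.pow _).mul ((hx1.mul hz1).pow _)
    exact (hunit.mul_right_eq_zero).1 h1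

end StepanovCore

section StepanovCount
open Polynomial

lemma frob_add {F B : Type*} [Field F] [Fintype F] [CommRing B] [Algebra F B] (u v : B) (k : ℕ) :
    (u + v) ^ (Fintype.card F ^ k) = u ^ (Fintype.card F ^ k) + v ^ (Fintype.card F ^ k) := by
  induction k with
  | zero => simp
  | succ k ih =>
    have := map_add (FiniteField.frobeniusAlgHom F B) (u ^ (Fintype.card F ^ k))
      (v ^ (Fintype.card F ^ k))
    simp only [FiniteField.coe_frobeniusAlgHom] at this
    rw [pow_succ, pow_mul, ih, this, pow_mul, pow_mul]

lemma frob_sub {F B : Type*} [Field F] [Fintype F] [CommRing B] [Algebra F B] (u v : B) (k : ℕ) :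
    (u - v) ^ (Fintype.card F ^ k) = u ^ (Fintype.card F ^ k) - v ^ (Fintype.card F ^ k) := by
  have := frob_add (F := F) (u - v) v k
  rw [sub_add_cancel] at this
  rw [this, add_sub_cancel_right]

theorem stepanov_count {F K : Type*} [Field F] [Fintype F] [Field K] [Algebra F K]
    (q s : ℕ) (hF : Fintype.card F = q) (hq : 3 ≤ q) (a b c : F) (ha : a ≠ 0) (S : Finset K)
    (hS : ∀ x ∈ S, x ≠ 0 ∧ x ^ (q ^ (2 * s + 2)) = x ∧
      ∑ k ∈ range (2 * s + 2), (a • x ^ (q ^ k) + b • (x⁻¹) ^ (q ^ k)) = algebraMap F K c) :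
    S.card ≤ (q ^ s + 9) * q ^ (s + 1) := by
  classical
  set L := q ^ (s + 1) with hL
  have hLpos : 0 < L := by positivity
  let I : S → Ideal K[X] := fun i => Ideal.span {(X - C (i : K)) ^ L}
  let x : (i : S) → K[X] ⧸ I i := fun i => Ideal.Quotient.mk _ X
  let φ : (i : S) → K →ₐ[F] K[X] ⧸ I i := fun i =>
    (Ideal.Quotient.mkₐ F (I i)).comp ((CAlgHom : K →ₐ[K] K[X]).restrictScalars F)
  let z : (i : S) → K[X] ⧸ I i := fun i => φ i i
  let z' : (i : S) → K[X] ⧸ I i := fun i => φ i (i : K)⁻¹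
  have hz : z * z' = 1 := by
    funext i
    simp only [Pi.mul_apply, Pi.one_apply, z, z']
    rw [← map_mul, mul_inv_cancel₀ (hS i i.2).1, map_one]
  have hxz : x ^ L = z ^ L := by
    funext i
    simp only [Pi.pow_apply, x, z]
    rw [← sub_eq_zero]
    have : (X : K[X]) ^ L - (C (i : K)) ^ L = (X - C (i : K)) ^ L := by
      rw [hL, ← hF]
      exact (frob_sub (F := F) _ _ _).symm
    change Ideal.Quotient.mk (I i) X ^ L - (Ideal.Quotient.mk (I i) (C (i : K))) ^ L = 0
    rw [← map_pow, ← map_pow, ← map_sub, this, Ideal.Quotient.eq_zero_iff_mem]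
    exact Ideal.mem_span_singleton_self _
  have hx : x * (x ^ (L - 1) * z' ^ L) = 1 := by
    rw [← mul_assoc, ← pow_succ', Nat.sub_add_cancel hLpos, hxz, ← mul_pow, hz, one_pow]
  obtain ⟨R, hR0, hRdeg, hR⟩ := stepanov_core q s hq a b c ha x _ z z' hx hz hxz
    (by
      funext i
      simp only [Pi.pow_apply, z]
      rw [← map_pow, (hS i i.2).2.1])
    (by
      funext i
      have := congrArg (φ i) (hS i i.2).2.2
      simp only [map_sum, map_add, map_smul, map_pow, AlgHom.commutes] at this
      simp only [Finset.sum_apply, Pi.add_apply, Pi.smul_apply, Pi.pow_apply, z, z']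
      exact this)
  have hdvd : ∀ i : S, (X - C (i : K)) ^ L ∣ R.map (algebraMap F K) := by
    intro i
    have h1 := congrFun hR i
    have h2 : aeval (x i) R = 0 := by
      have := Polynomial.aeval_algHom_apply (Pi.evalAlgHom F (fun i : S => K[X] ⧸ I i) i) x R
      simp only [Pi.evalAlgHom_apply] at this
      rw [this, hR, Pi.zero_apply]
    have h3 : aeval (x i) R = Ideal.Quotient.mk (I i) (R.map (algebraMap F K)) := by
      have := Polynomial.aeval_algHom_apply (Ideal.Quotient.mkₐ F (I i)) X R
      simp only [Ideal.Quotient.mkₐ_eq_mk] at this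
      rw [show x i = Ideal.Quotient.mk (I i) X from rfl, this]
      congr 1
    rw [h3, Ideal.Quotient.eq_zero_iff_mem, Ideal.mem_span_singleton] at h2
    exact h2
  have hprod : ∏ i : S, (X - C (i : K)) ^ L ∣ R.map (algebraMap F K) := by
    apply Finset.prod_dvd_of_coprime
    · intro i _ j _ hij
      apply IsCoprime.pow
      apply isCoprime_X_sub_C_of_isUnit_sub
      rw [isUnit_iff_ne_zero, sub_ne_zero]
      exact fun h => hij (Subtype.ext h)
    · intro i _
      exact hdvd i
  have hdeg := natDegree_le_of_dvd hprod
    (by rwa [Ne, Polynomial.map_eq_zero])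
  rw [natDegree_map, natDegree_prod_of_monic _ _ (fun i _ => (monic_X_sub_C _).pow _)] at hdeg
  simp only [natDegree_pow, natDegree_X_sub_C, mul_one, sum_const, smul_eq_mul, card_univ,
    Fintype.card_coe] at hdeg
  have h4 : S.card * L < ((q ^ s + 9) * L) * L := by
    refine lt_of_le_of_lt hdeg (lt_of_lt_of_eq hRdeg ?_)
    rw [hL]
    ring
  exact (Nat.lt_of_mul_lt_mul_right h4).le

end StepanovCount

section FrobMinpoly
open Polynomial

variable {F K : Type*} [Field F] [Fintype F] [Field K] [Algebra F K]

lemma mem_range_of_frob_fixed (y : K) (hy : y ^ Fintype.card F = y) :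
    ∃ c : F, algebraMap F K c = y := by
  have h := FiniteField.X_pow_card_sub_X_natDegree_eq F (Fintype.one_lt_card (α := F))
  have hr := FiniteField.roots_X_pow_card_sub_X F
  have hm : (X ^ Fintype.card F - X : F[X]).Monic := by
    apply monic_X_pow_sub
    simpa using Fintype.one_lt_card (α := F)
  have hs := Polynomial.prod_multiset_X_sub_C_of_monic_of_roots_card_eq hm (by
    rw [hr, h]; rfl)
  rw [hr] at hs
  have h2 := congrArg (aeval y) hs
  have h3 : aeval y (∏ c : F, (X - C c)) = 0 := by
    refine Eq.trans h2 ?_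
    simp [hy]
  rw [map_prod, Finset.prod_eq_zero_iff] at h3
  obtain ⟨c, _, hc⟩ := h3
  refine ⟨c, ?_⟩
  simp only [map_sub, aeval_X, aeval_C] at hc
  exact (sub_eq_zero.1 hc).symm

lemma frob_fixed_iff (x : K) (hx : IsIntegral F x) (k : ℕ) :
    x ^ (Fintype.card F ^ k) = x ↔ (minpoly F x).natDegree ∣ k := by
  rw [(minpoly.irreducible hx).natDegree_dvd_iff_dvd_X_pow_card_pow_sub_X,
    ← minpoly.isIntegrallyClosed_dvd_iff hx]
  simp [sub_eq_zero]

lemma frob_injective (k : ℕ) : Function.Injective (fun x : K => x ^ (Fintype.card F ^ k)) := by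
  intro u v h
  simp only at h
  rw [← sub_eq_zero, ← frob_sub (F := F)] at h
  exact sub_eq_zero.1 (eq_zero_of_pow_eq_zero h)

lemma minpoly_map_eq (x : K) (hx : IsIntegral F x) :
    (minpoly F x).map (algebraMap F K) =
      ∏ i ∈ range (minpoly F x).natDegree, (X - C (x ^ (Fintype.card F ^ i))) := by
  set e := (minpoly F x).natDegree with he
  have hmon := minpoly.monic hx
  apply eq_of_monic_of_dvd_of_natDegree_le (p := ∏ i ∈ range e, (X - C (x ^ (Fintype.card F ^ i))))
  · exact monic_prod_of_monic _ _ fun i _ => monic_X_sub_C _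
  · exact hmon.map _
  · apply Finset.prod_dvd_of_coprime
    · have key : ∀ i j : ℕ, i < j → j < e → x ^ (Fintype.card F ^ i) ≠ x ^ (Fintype.card F ^ j) := by
        intro i j hij hj h
        obtain ⟨r, rfl⟩ : ∃ r, j = r + i := ⟨j - i, by omega⟩
        rw [pow_add, pow_mul] at h
        have h1 := frob_injective (F := F) (K := K) i h
        have h2 := (frob_fixed_iff (F := F) x hx r).1 h1.symm
        have := Nat.le_of_dvd (by omega) h2
        omega
      intro i hi j hj hij
      apply isCoprime_X_sub_C_of_isUnit_sub
      rw [isUnit_iff_ne_zero, sub_ne_zero]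
      simp only [coe_range, Set.mem_Iio] at hi hj
      rcases lt_or_gt_of_ne hij with h | h
      · exact key i j h hj
      · exact (key j i h hi).symm
    · intro i _
      rw [dvd_iff_isRoot, IsRoot, eval_map_algebraMap]
      induction i with
      | zero => simp
      | succ i ih =>
        have := Polynomial.aeval_algHom_apply (FiniteField.frobeniusAlgHom F K)
          (x ^ (Fintype.card F ^ i)) (minpoly F x)
        rw [ih (by simp only [mem_range] at *; omega), map_zero] at this
        simp only [FiniteField.coe_frobeniusAlgHom] at this
        rw [pow_succ, pow_mul, this]
  · rw [natDegree_map, natDegree_prod_of_monic _ _ (fun i _ => (monic_X_sub_C _))]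
    simp only [natDegree_X_sub_C, sum_const, card_range, smul_eq_mul, mul_one]
    exact le_rfl

lemma prod_range_mul_period {M : Type*} [CommMonoid M] (f : ℕ → M) (e j : ℕ)
    (hf : ∀ i, f (i + e) = f i) : ∏ i ∈ range (e * j), f i = (∏ i ∈ range e, f i) ^ j := by
  have h : ∀ j i, f (e * j + i) = f i := by
    intro j
    induction j with
    | zero => simp
    | succ j ih =>
      intro i
      rw [show e * (j + 1) + i = e * j + i + e by ring, hf, ih]
  induction j with
  | zero => simp
  | succ j ih => rw [Nat.mul_succ, prod_range_add, ih, pow_succ]; simp [h]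

/-- The characteristic polynomial of `x` in the extension of degree `k`. -/
noncomputable def chp (F : Type*) {K : Type*} [Field F] [Field K] [Algebra F K] (k : ℕ) (x : K) :
    F[X] := minpoly F x ^ (k / (minpoly F x).natDegree)

lemma chp_map (x : K) (hx : IsIntegral F x) (k : ℕ) (hk : x ^ (Fintype.card F ^ k) = x) :
    (chp F k x).map (algebraMap F K) = ∏ i ∈ range k, (X - C (x ^ (Fintype.card F ^ i))) := by
  have hd := (frob_fixed_iff (F := F) x hx k).1 hk
  obtain ⟨j, hj⟩ := hd
  have hpos := minpoly.natDegree_pos hx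
  unfold chp
  rw [Polynomial.map_pow, minpoly_map_eq x hx, ← prod_range_mul_period]
  · rw [Nat.mul_div_cancel' ⟨j, hj⟩]
  · intro i
    have := (frob_fixed_iff (F := F) x hx (minpoly F x).natDegree).2 dvd_rfl
    rw [add_comm, pow_add, pow_mul, this]

lemma chp_monic (x : K) (hx : IsIntegral F x) (k : ℕ) : (chp F k x).Monic :=
  (minpoly.monic hx).pow _

lemma chp_natDegree (x : K) (hx : IsIntegral F x) (k : ℕ) (hk : x ^ (Fintype.card F ^ k) = x) :
    (chp F k x).natDegree = k := by
  unfold chp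
  rw [natDegree_pow, Nat.div_mul_cancel ((frob_fixed_iff (F := F) x hx k).1 hk)]

end FrobMinpoly

section LFunction
open Polynomial

variable {F K : Type*} [Field F] [Fintype F] [Field K] [Algebra F K]

/-- The completely multiplicative function on monic polynomials attached to `a x + b / x`. -/
noncomputable def psi (χ : AddChar F ℂ) (a b : F) (h : F[X]) : ℂ :=
  open Classical in
  if h.coeff 0 = 0 then 0 else χ (-(a * h.nextCoeff + b * (h.coeff 1 / h.coeff 0)))

lemma psi_one (χ : AddChar F ℂ) (a b : F) : psi χ a b 1 = 1 := by
  have : (1 : F[X]).nextCoeff = 0 := by simp [nextCoeff]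
  simp [psi, this, coeff_one]

lemma coeff_one_mul {R : Type*} [CommRing R] (p r : R[X]) : (p * r).coeff 1 = p.coeff 0 * r.coeff 1 + p.coeff 1 * r.coeff 0 := by
  rw [coeff_mul, Finset.Nat.sum_antidiagonal_eq_sum_range_succ_mk]
  simp [sum_range_succ]

lemma psi_mul (χ : AddChar F ℂ) (a b : F) {p r : F[X]} (hp : p.Monic) (hr : r.Monic) :
    psi χ a b (p * r) = psi χ a b p * psi χ a b r := by
  unfold psi
  by_cases h1 : p.coeff 0 = 0
  · simp [h1]
  by_cases h2 : r.coeff 0 = 0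
  · simp [h2]
  have h12 : (p * r).coeff 0 ≠ 0 := by rw [mul_coeff_zero]; exact mul_ne_zero h1 h2
  rw [if_neg h1, if_neg h2, if_neg h12, mul_coeff_zero, coeff_one_mul, hp.nextCoeff_mul hr]
  rw [← AddChar.map_add_eq_mul]
  congr 1
  field_simp
  ring

lemma coeff_prod_X_sub_C {ι : Type*} (s : Finset ι) (y : ι → K) (hy : ∀ i ∈ s, y i ≠ 0) :
    (∏ i ∈ s, (X - C (y i))).coeff 0 ≠ 0 ∧
    (∏ i ∈ s, (X - C (y i))).coeff 1 = -(∑ i ∈ s, (y i)⁻¹) * (∏ i ∈ s, (X - C (y i))).coeff 0 := by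
  classical
  induction s using Finset.induction_on with
  | empty => simp [coeff_one]
  | insert i s hi ih =>
    obtain ⟨h1, h2⟩ := ih fun j hj => hy j (mem_insert_of_mem hj)
    have h3 := hy i (mem_insert_self _ _)
    rw [prod_insert hi, sum_insert hi, mul_coeff_zero, coeff_one_mul, h2]
    simp only [coeff_sub, coeff_X_zero, coeff_C_zero, coeff_X_one, coeff_C_succ, zero_sub]
    refine ⟨mul_ne_zero (neg_ne_zero.2 h3) h1, ?_⟩
    field_simp
    ring

lemma psi_chp (χ : AddChar F ℂ) (a b : F) (x : K) (hx : IsIntegral F x) (hx0 : x ≠ 0) (k : ℕ)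
    (hk : x ^ (Fintype.card F ^ k) = x) (c : F)
    (hc : ∑ i ∈ range k, (a • x ^ (Fintype.card F ^ i) + b • (x⁻¹) ^ (Fintype.card F ^ i))
      = algebraMap F K c) : psi χ a b (chp F k x) = χ c := by
  have hm := chp_map x hx k hk
  obtain ⟨h1, h2⟩ := coeff_prod_X_sub_C (range k) (fun i => x ^ (Fintype.card F ^ i))
    (fun i _ => pow_ne_zero _ hx0)
  have hinj := (algebraMap F K).injective
  have h3 : algebraMap F K (chp F k x).nextCoeff = -∑ i ∈ range k, x ^ (Fintype.card F ^ i) := by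
    rw [← nextCoeff_map hinj, hm, prod_X_sub_C_nextCoeff]
  rw [← hm, coeff_map] at h1
  rw [← hm, coeff_map, coeff_map] at h2
  have h0 : (chp F k x).coeff 0 ≠ 0 := fun h => h1 (by rw [h, map_zero])
  unfold psi
  rw [if_neg h0]
  congr 1
  apply hinj
  rw [← hc, map_neg, map_add, map_mul, map_mul, map_div₀, h2, h3, sum_add_distrib,
    ← smul_sum, ← smul_sum, Algebra.smul_def, Algebra.smul_def]
  simp only [inv_pow]
  field_simp
  ring

lemma psi_chp_zero (χ : AddChar F ℂ) (a b : F) (k : ℕ) (hk : 0 < k) :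
    psi χ a b (chp F k (0 : K)) = 0 := by
  unfold psi chp
  rw [minpoly.zero, if_pos]
  simp [coeff_X_pow]
  omega

lemma finite_monic (n : ℕ) : {p : F[X] | p.Monic ∧ p.natDegree = n}.Finite := by
  have h : Finite (degreeLT F (n + 1)) :=
    Finite.of_equiv _ (degreeLTEquiv F (n + 1)).symm.toEquiv
  refine Set.Finite.subset (Set.toFinite (degreeLT F (n + 1) : Set F[X])) ?_
  rintro p ⟨hp, hn⟩
  rw [SetLike.mem_coe, mem_degreeLT, degree_eq_natDegree hp.ne_zero, hn]
  exact_mod_cast Nat.lt_succ_self n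

/-- Monic polynomials of degree `n`. -/
noncomputable def Mon (F : Type*) [Field F] [Fintype F] (n : ℕ) : Finset F[X] :=
  (finite_monic (F := F) n).toFinset

lemma mem_Mon {n : ℕ} {p : F[X]} : p ∈ Mon F n ↔ p.Monic ∧ p.natDegree = n := by
  simp [Mon]

/-- Coefficients of the L-function. -/
noncomputable def Ssum (χ : AddChar F ℂ) (a b : F) (n : ℕ) : ℂ := ∑ h ∈ Mon F n, psi χ a b h

/-- Elements of `K` of degree dividing `k`. -/
noncomputable def FixPts (F K : Type*) [Field F] [Fintype F] [Field K] (k : ℕ) : Finset K :=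
  open Classical in (X ^ (Fintype.card F ^ k) - X : K[X]).roots.toFinset

lemma mem_FixPts {k : ℕ} (hk : 0 < k) {x : K} : x ∈ FixPts F K k ↔ x ^ (Fintype.card F ^ k) = x := by
  classical
  unfold FixPts
  rw [Multiset.mem_toFinset, mem_roots (FiniteField.X_pow_card_pow_sub_X_ne_zero K hk.ne'
    (Fintype.one_lt_card))]
  simp [sub_eq_zero]

/-- Companion sums over extensions. -/
noncomputable def Ksum (F K : Type*) [Field F] [Fintype F] [Field K] [Algebra F K]
    (χ : AddChar F ℂ) (a b : F) (k : ℕ) : ℂ := ∑ x ∈ FixPts F K k, psi χ a b (chp F k x)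

lemma rootMult_minpoly (x : K) (hx : IsIntegral F x) :
    rootMultiplicity x ((minpoly F x).map (algebraMap F K)) = 1 := by
  have hirr := minpoly.irreducible hx
  have hsep : (minpoly F x).Separable := PerfectField.separable_of_irreducible hirr
  apply le_antisymm
  · exact rootMultiplicity_le_one_of_separable hsep.map x
  · rw [Nat.one_le_iff_ne_zero, Ne, rootMultiplicity_eq_zero_iff]
    push Not
    refine ⟨?_, ((minpoly.monic hx).map _).ne_zero⟩
    rw [IsRoot, eval_map_algebraMap, minpoly.aeval]

lemma minpoly_pow_dvd_iff (x : K) (hx : IsIntegral F x) (j : ℕ) (h : F[X]) (h0 : h ≠ 0) :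
    minpoly F x ^ j ∣ h ↔ j ≤ rootMultiplicity x (h.map (algebraMap F K)) := by
  have hP0 := (minpoly.monic hx).ne_zero
  induction j generalizing h with
  | zero => simp
  | succ j ih =>
    have key : ∀ g : F[X], g ≠ 0 → (minpoly F x ^ (j + 1) ∣ minpoly F x * g ↔
        j + 1 ≤ rootMultiplicity x ((minpoly F x * g).map (algebraMap F K))) := by
      intro g hg
      have ihg := ih g hg
      rw [pow_succ', mul_dvd_mul_iff_left hP0]
      refine ihg.trans ?_
      rw [Polynomial.map_mul, rootMultiplicity_mul,
        rootMult_minpoly x hx]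
      · omega
      · rw [← Polynomial.map_mul, Ne, Polynomial.map_eq_zero]
        exact mul_ne_zero hP0 hg
    constructor
    · intro hd
      obtain ⟨g, rfl⟩ : minpoly F x ∣ h := (dvd_pow_self _ (Nat.succ_ne_zero j)).trans hd
      exact (key g (right_ne_zero_of_mul h0)).1 hd
    · intro hd
      have hroot : IsRoot (h.map (algebraMap F K)) x := by
        by_contra hr
        rw [rootMultiplicity_eq_zero hr] at hd
        omega
      rw [IsRoot, eval_map_algebraMap] at hroot
      obtain ⟨g, rfl⟩ := minpoly.dvd F x hroot
      exact (key g (right_ne_zero_of_mul h0)).2 hd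

open Classical in
lemma card_chp_dvd (x : K) (hx : IsIntegral F x) (h : F[X]) (h0 : h ≠ 0) :
    ((Icc 1 h.natDegree).filter fun k => x ∈ FixPts F K k ∧ chp F k x ∣ h).card
      = rootMultiplicity x (h.map (algebraMap F K)) := by
  classical
  have hpos := minpoly.natDegree_pos hx
  have : ((Icc 1 h.natDegree).filter fun k => x ∈ FixPts F K k ∧ chp F k x ∣ h) =
      (Icc 1 (rootMultiplicity x (h.map (algebraMap F K)))).image
        fun j => (minpoly F x).natDegree * j := by
    ext k
    simp only [mem_filter, mem_image, mem_Icc]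
    constructor
    · rintro ⟨⟨hk1, hk2⟩, hfix, hdvd⟩
      rw [mem_FixPts hk1, frob_fixed_iff x hx] at hfix
      obtain ⟨j, rfl⟩ := hfix
      unfold chp at hdvd
      rw [Nat.mul_div_cancel_left _ hpos, minpoly_pow_dvd_iff x hx _ _ h0] at hdvd
      refine ⟨j, ⟨?_, hdvd⟩, rfl⟩
      exact Nat.pos_of_mul_pos_left hk1
    · rintro ⟨j, ⟨hj1, hj2⟩, rfl⟩
      have hd := (minpoly_pow_dvd_iff x hx j h h0).2 hj2
      have hk : 0 < (minpoly F x).natDegree * j := Nat.mul_pos hpos hj1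
      refine ⟨⟨hk, ?_⟩, ?_, ?_⟩
      · have := natDegree_le_of_dvd hd h0
        rwa [natDegree_pow, mul_comm] at this
      · rw [mem_FixPts hk, frob_fixed_iff x hx]
        exact dvd_mul_right _ _
      · unfold chp
        rwa [Nat.mul_div_cancel_left _ hpos]
  rw [this, card_image_of_injective, Nat.card_Icc, Nat.add_sub_cancel]
  exact fun u v huv => Nat.eq_of_mul_eq_mul_left hpos huv

variable [IsAlgClosed K] [Algebra.IsAlgebraic F K]

open Classical in
lemma count_pairs (h : F[X]) (h0 : h ≠ 0) :
    ∑ k ∈ Icc 1 h.natDegree, ((FixPts F K k).filter fun x => chp F k x ∣ h).card = h.natDegree := by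
  classical
  have hintg : ∀ x : K, IsIntegral F x := fun x => Algebra.IsIntegral.isIntegral x
  set T := (h.map (algebraMap F K)).roots.toFinset with hT
  have h1 : ∀ k ∈ Icc 1 h.natDegree, ((FixPts F K k).filter fun x => chp F k x ∣ h)
      = T.filter fun x => x ∈ FixPts F K k ∧ chp F k x ∣ h := by
    intro k hk
    ext x
    simp only [mem_filter]
    constructor
    · rintro ⟨hf, hd⟩
      refine ⟨?_, hf, hd⟩
      rw [hT, Multiset.mem_toFinset, mem_roots (by rwa [Ne, Polynomial.map_eq_zero]), IsRoot,
        eval_map_algebraMap]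
      have hk1 := (mem_Icc.1 hk).1
      have hk2 := (frob_fixed_iff x (hintg x) k).1 ((mem_FixPts hk1).1 hf)
      have : minpoly F x ∣ h := by
        refine (dvd_pow_self _ ?_).trans hd
        exact (Nat.div_pos (Nat.le_of_dvd hk1 hk2) (minpoly.natDegree_pos (hintg x))).ne'
      obtain ⟨g, rfl⟩ := this
      simp
    · rintro ⟨_, hf, hd⟩
      exact ⟨hf, hd⟩
  rw [sum_congr rfl fun k hk => by rw [h1 k hk]]
  simp only [card_filter]
  rw [sum_comm]
  have h2 : ∀ x ∈ T, (∑ k ∈ Icc 1 h.natDegree, if x ∈ FixPts F K k ∧ chp F k x ∣ h then 1 else 0)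
      = (h.map (algebraMap F K)).roots.count x := by
    intro x _
    rw [← card_filter, card_chp_dvd x (hintg x) h h0, count_roots]
  rw [sum_congr rfl h2, hT, Multiset.toFinset_sum_count_eq]
  rw [← (IsAlgClosed.splits (h.map (algebraMap F K))).natDegree_eq_card_roots, natDegree_map]

theorem newton (χ : AddChar F ℂ) (a b : F) (n : ℕ) :
    (n : ℂ) * Ssum χ a b n = ∑ k ∈ Icc 1 n, Ksum F K χ a b k * Ssum χ a b (n - k) := by
  classical
  have hintg : ∀ x : K, IsIntegral F x := fun x => Algebra.IsIntegral.isIntegral x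
  have h1 : ∀ k ∈ Icc 1 n, Ksum F K χ a b k * Ssum χ a b (n - k) =
      ∑ h ∈ Mon F n, ((FixPts F K k).filter fun x => chp F k x ∣ h).card * psi χ a b h := by
    intro k hk
    obtain ⟨hk1, hk2⟩ := mem_Icc.1 hk
    unfold Ksum Ssum
    rw [sum_mul_sum]
    have h2 : ∀ x ∈ FixPts F K k, ∑ h ∈ Mon F (n - k), psi χ a b (chp F k x) * psi χ a b h
        = ∑ h ∈ Mon F n, if chp F k x ∣ h then psi χ a b h else 0 := by
      intro x hx
      have hd := chp_natDegree x (hintg x) k ((mem_FixPts hk1).1 hx)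
      have hmon := chp_monic x (hintg x) k
      rw [← sum_filter]
      refine sum_bij (fun h _ => chp F k x * h) ?_ ?_ ?_ ?_
      · intro h hh
        rw [mem_Mon] at hh
        rw [mem_filter, mem_Mon, hmon.natDegree_mul hh.1, hd, hh.2]
        exact ⟨⟨hmon.mul hh.1, by omega⟩, dvd_mul_right _ _⟩
      · intro h _ h' _ he
        exact mul_left_cancel₀ hmon.ne_zero he
      · intro h hh
        rw [mem_filter, mem_Mon] at hh
        obtain ⟨⟨hm, hn⟩, g, rfl⟩ := hh
        have hg : g.Monic := hmon.of_mul_monic_left hm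
        rw [hmon.natDegree_mul hg, hd] at hn
        exact ⟨g, by rw [mem_Mon]; exact ⟨hg, by omega⟩, rfl⟩
      · intro h hh
        rw [psi_mul χ a b hmon (mem_Mon.1 hh).1]
    rw [sum_congr rfl h2, sum_comm]
    refine sum_congr rfl fun h _ => ?_
    rw [← sum_filter, sum_const, nsmul_eq_mul]
  rw [sum_congr rfl h1, sum_comm]
  unfold Ssum
  rw [mul_sum]
  refine sum_congr rfl fun h hh => ?_
  rw [mem_Mon] at hh
  rw [← sum_mul]
  congr 1
  have := count_pairs (F := F) (K := K) h hh.1.ne_zero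
  rw [hh.2] at this
  exact_mod_cast this.symm

end LFunction

section KloostermanRec
open Polynomial

variable {F : Type*} [Field F] [Fintype F]

/-- Kloosterman sum. -/
noncomputable def klo (χ : AddChar F ℂ) (a b : F) : ℂ :=
  open Classical in ∑ x : F, if x = 0 then 0 else χ (a * x + b * x⁻¹)

lemma Ssum_zero (χ : AddChar F ℂ) (a b : F) : Ssum χ a b 0 = 1 := by
  have : Mon F 0 = {1} := by
    ext p
    rw [mem_Mon, mem_singleton]
    constructor
    · rintro ⟨h1, h2⟩
      exact h1.natDegree_eq_zero.1 h2
    · rintro rfl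
      exact ⟨monic_one, natDegree_one⟩
  rw [Ssum, this, sum_singleton, psi_one]

lemma Ssum_one (χ : AddChar F ℂ) (a b : F) : Ssum χ a b 1 = klo χ a b := by
  classical
  unfold Ssum klo
  symm
  refine sum_bij (fun c _ => X - C c) ?_ ?_ ?_ ?_
  · intro c _
    rw [mem_Mon]
    exact ⟨monic_X_sub_C c, natDegree_X_sub_C c⟩
  · intro c _ c' _ h
    simpa using h
  · intro p hp
    obtain ⟨h1, h2⟩ := mem_Mon.1 hp
    refine ⟨-p.coeff 0, mem_univ _, ?_⟩
    have := eq_X_add_C_of_natDegree_le_one h2.le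
    rw [show p.coeff 1 = 1 from by rw [← h2]; exact h1] at this
    rw [this]
    simp
  · intro c _
    unfold psi
    simp only [nextCoeff_X_sub_C, coeff_sub, coeff_X_zero, coeff_C_zero, coeff_X_one, coeff_C_succ,
      zero_sub, sub_zero, neg_eq_zero]
    by_cases hc : c = 0
    · simp [hc]
    · rw [if_neg hc, if_neg (by simpa using hc)]
      congr 1
      field_simp
      ring

lemma Ssum_two (χ : AddChar F ℂ) (hχ : χ ≠ 1) (a b : F) (ha : a ≠ 0) (hb : b ≠ 0) :
    Ssum χ a b 2 = Fintype.card F := by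
  classical
  have hprim : χ.IsPrimitive := AddChar.IsPrimitive.of_ne_one hχ
  have h1 : Ssum χ a b 2 = ∑ c : F × F, if c.1 = 0 then 0 else χ (c.2 * (-(a + b * c.1⁻¹))) := by
    unfold Ssum
    symm
    refine sum_bij (fun c _ => X ^ 2 + (C c.2 * X + C c.1)) ?_ ?_ ?_ ?_
    · intro c _
      rw [mem_Mon]
      have hm : (X ^ 2 + (C c.2 * X + C c.1)).Monic := by monicity!
      refine ⟨hm, ?_⟩
      compute_degree!
    · intro c _ c' _ h
      have e0 := congrArg (fun p => p.coeff 0) h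
      have e1 := congrArg (fun p => p.coeff 1) h
      simp [coeff_X] at e0 e1
      exact Prod.ext e0 e1
    · intro p hp
      obtain ⟨h1, h2⟩ := mem_Mon.1 hp
      refine ⟨(p.coeff 0, p.coeff 1), mem_univ _, ?_⟩
      have h3 : p.coeff 2 = 1 := by rw [← h2]; exact h1
      conv_rhs => rw [p.as_sum_range_C_mul_X_pow, h2]
      simp [sum_range_succ, h3]
      ring
    · intro c _
      unfold psi
      have hd : (X ^ 2 + (C c.2 * X + C c.1)).natDegree = 2 := by compute_degree!
      have hn : (X ^ 2 + (C c.2 * X + C c.1)).nextCoeff = c.2 := by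
        rw [nextCoeff, hd]; simp [coeff_X]
      rw [hn]
      have e0 : (X ^ 2 + (C c.2 * X + C c.1)).coeff 0 = c.1 := by simp
      have e1 : (X ^ 2 + (C c.2 * X + C c.1)).coeff 1 = c.2 := by simp [coeff_X]
      rw [e1]
      by_cases hc : c.1 = 0
      · rw [if_pos hc, if_pos (e0.trans hc)]
      · rw [if_neg hc, if_neg (by rw [e0]; exact hc), e0]
        congr 1
        field_simp
  rw [h1, Fintype.sum_prod_type]
  rw [sum_eq_single (-b * a⁻¹)]
  · have : -b * a⁻¹ ≠ 0 := mul_ne_zero (neg_ne_zero.2 hb) (inv_ne_zero ha)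
    simp only [this, if_false]
    have e : a + b * (-b * a⁻¹)⁻¹ = 0 := by field_simp; ring
    simp only [e]
    simp
  · intro x _ hx
    by_cases h0 : x = 0
    · simp [h0]
    · simp only [h0, if_false]
      have := AddChar.sum_mulShift (-(a + b * x⁻¹)) hprim
      rw [this, if_neg]
      · simp
      · intro h
        apply hx
        field_simp at h ⊢
        linear_combination -h
  · simp

lemma Ssum_ge_three (χ : AddChar F ℂ) (hχ : χ ≠ 1) (a b : F) (ha : a ≠ 0) (n : ℕ) (hn : 3 ≤ n) :
    Ssum χ a b n = 0 := by
  classical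
  obtain ⟨u, hu⟩ := (AddChar.ne_one_iff).1 hχ
  set t := -u * a⁻¹ with ht
  have hmem : ∀ s : F, ∀ p ∈ Mon F n, p + C s * X ^ (n - 1) ∈ Mon F n := by
    intro s p hp
    rw [mem_Mon] at hp ⊢
    have hlt : (C s * X ^ (n - 1)).degree < p.degree := by
      rw [degree_eq_natDegree hp.1.ne_zero, hp.2]
      refine (degree_C_mul_X_pow_le _ _).trans_lt ?_
      exact_mod_cast (by omega : n - 1 < n)
    refine ⟨hp.1.add_of_left hlt, ?_⟩
    rw [natDegree_add_eq_left_of_degree_lt hlt, hp.2]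
  have h : Ssum χ a b n = χ u * Ssum χ a b n := by
    conv_rhs => unfold Ssum
    rw [mul_sum]
    unfold Ssum
    symm
    refine sum_bij (fun p _ => p + C t * X ^ (n - 1)) (hmem t) ?_ ?_ ?_
    · intro p _ p' _ h
      exact add_right_cancel h
    · intro p hp
      refine ⟨p + C (-t) * X ^ (n - 1), hmem _ p hp, ?_⟩
      simp
    · intro p hp
      have hp' := mem_Mon.1 (hmem t p hp)
      rw [mem_Mon] at hp
      have e0 : (p + C t * X ^ (n - 1)).coeff 0 = p.coeff 0 := by
        rw [coeff_add, coeff_C_mul_X_pow, if_neg (by omega), add_zero]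
      have e1 : (p + C t * X ^ (n - 1)).coeff 1 = p.coeff 1 := by
        rw [coeff_add, coeff_C_mul_X_pow, if_neg (by omega), add_zero]
      have e2 : (p + C t * X ^ (n - 1)).nextCoeff = p.nextCoeff + t := by
        rw [nextCoeff_of_natDegree_pos (by omega), nextCoeff_of_natDegree_pos (by omega), hp.2, hp'.2,
          coeff_add, coeff_C_mul_X_pow, if_pos rfl]
      unfold psi
      rw [e1, e2]
      by_cases hc : p.coeff 0 = 0
      · rw [if_pos hc, if_pos (e0.trans hc), mul_zero]
      · rw [if_neg hc, if_neg (by rw [e0]; exact hc), e0, ← AddChar.map_add_eq_mul]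
        congr 1
        rw [ht]
        field_simp
        ring
  have h2 : (χ u - 1) * Ssum χ a b n = 0 := by linear_combination -h
  exact (mul_eq_zero.1 h2).resolve_left (sub_ne_zero.2 hu)

variable (K : Type*) [Field K] [Algebra F K] [IsAlgClosed K] [Algebra.IsAlgebraic F K]

lemma Ksum_rec (χ : AddChar F ℂ) (hχ : χ ≠ 1) (a b : F) (ha : a ≠ 0) (hb : b ≠ 0) :
    Ksum F K χ a b 1 = klo χ a b ∧
    Ksum F K χ a b 2 = 2 * Fintype.card F - klo χ a b ^ 2 ∧
    ∀ n, Ksum F K χ a b (n + 3) = - klo χ a b * Ksum F K χ a b (n + 2)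
      - Fintype.card F * Ksum F K χ a b (n + 1) := by
  have h1 := newton (K := K) χ a b 1
  have h2 := newton (K := K) χ a b 2
  simp [Ssum_zero, Ssum_one] at h1
  rw [show Icc 1 2 = {1, 2} from rfl] at h2
  simp [Ssum_zero, Ssum_one, Ssum_two χ hχ a b ha hb] at h2
  refine ⟨h1.symm, ?_, ?_⟩
  · rw [← h1] at h2
    linear_combination -h2
  · intro n
    have h3 := newton (K := K) χ a b (n + 3)
    rw [Ssum_ge_three χ hχ a b ha (n + 3) (by omega), mul_zero, sum_Icc_succ_top (by omega),
      sum_Icc_succ_top (by omega), sum_Icc_succ_top (by omega)] at h3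
    rw [sum_eq_zero, zero_add] at h3
    · rw [show n + 3 - (n + 1) = 2 by omega, show n + 3 - (n + 1 + 1) = 1 by omega,
        show n + 3 - (n + 2 + 1) = 0 by omega, Ssum_zero, Ssum_one, Ssum_two χ hχ a b ha hb] at h3
      linear_combination -h3
    · intro k hk
      rw [mem_Icc] at hk
      rw [Ssum_ge_three χ hχ a b ha _ (by omega), mul_zero]

end KloostermanRec

section KloostermanBound
open Polynomial

variable {F : Type*} [Field F] [Fintype F]
variable (K : Type*) [Field K] [Algebra F K] [IsAlgClosed K] [Algebra.IsAlgebraic F K]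

lemma card_FixPts (k : ℕ) (hk : 0 < k) : (FixPts F K k).card = Fintype.card F ^ k := by
  classical
  obtain ⟨p, hp⟩ := CharP.exists F
  haveI : CharP K p := charP_of_injective_algebraMap (algebraMap F K).injective p
  have hdvd : p ∣ Fintype.card F ^ k := by
    refine dvd_pow ?_ hk.ne'
    rw [← CharP.cast_eq_zero_iff F]
    exact Nat.cast_card_eq_zero F
  have hsep := galois_poly_separable (K := K) p _ hdvd
  have hc : 1 < Fintype.card F := Fintype.one_lt_card
  unfold FixPts
  rw [Multiset.toFinset_card_of_nodup (nodup_roots hsep),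
    ← (IsAlgClosed.splits _).natDegree_eq_card_roots]
  exact FiniteField.X_pow_card_pow_sub_X_natDegree_eq K hk.ne' hc

/-- The trace expression. -/
def trE (F : Type*) {K : Type*} [Field F] [Fintype F] [Field K] [Algebra F K] (a b : F) (k : ℕ) (x : K) : K :=
  ∑ i ∈ range k, (a • x ^ (Fintype.card F ^ i) + b • (x⁻¹) ^ (Fintype.card F ^ i))

lemma trE_mem {K : Type*} [Field K] [Algebra F K] (a b : F) (k : ℕ) (x : K) (hx : x ^ (Fintype.card F ^ k) = x) :
    ∃ c, algebraMap F K c = trE F a b k x := by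
  apply mem_range_of_frob_fixed
  have h : ∀ y : K, y ^ Fintype.card F = FiniteField.frobeniusAlgHom F K y := fun y => rfl
  rw [h]
  unfold trE
  rw [map_sum]
  have h2 : ∀ i, FiniteField.frobeniusAlgHom F K (a • x ^ (Fintype.card F ^ i) + b • (x⁻¹) ^ (Fintype.card F ^ i))
     = (a • x ^ (Fintype.card F ^ (i+1)) + b • (x⁻¹) ^ (Fintype.card F ^ (i+1))) := by
    intro i
    rw [map_add, map_smul, map_smul, ← h, ← h, ← pow_mul, ← pow_mul, ← pow_succ]
  simp only [h2]
  have e := sum_range_succ (fun i => (a • x ^ (Fintype.card F ^ i) + b • (x⁻¹) ^ (Fintype.card F ^ i))) k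
  rw [sum_range_succ'] at e
  have e2 : (x⁻¹) ^ (Fintype.card F ^ k) = x⁻¹ := by rw [inv_pow, hx]
  rw [hx, e2, pow_zero, pow_one, pow_one] at e
  exact add_right_cancel e

lemma charsum_bound (χ : AddChar F ℂ) (hχ : χ ≠ 1) (N : F → ℝ) (U : ℝ) (hU : ∀ c, N c ≤ U) :
    ‖∑ c, (N c : ℂ) * χ c‖ ≤ Fintype.card F * U - ∑ c, N c := by
  have h0 : ∑ c, χ c = 0 := by
    rw [AddChar.sum_eq_zero_iff_ne_zero]
    exact hχ
  have h1 : ∑ c, (N c : ℂ) * χ c = ∑ c, ((N c - U : ℝ) : ℂ) * χ c := by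
    push_cast
    simp only [sub_mul, sum_sub_distrib, ← mul_sum, h0, mul_zero, sub_zero]
  rw [h1]
  refine (norm_sum_le _ _).trans ?_
  have : ∀ c, ‖((N c - U : ℝ) : ℂ) * χ c‖ = U - N c := by
    intro c
    rw [norm_mul, AddChar.norm_apply, mul_one, Complex.norm_real, Real.norm_eq_abs, abs_of_nonpos]
    · ring
    · linarith [hU c]
  simp only [this, sum_sub_distrib, sum_const, card_univ, nsmul_eq_mul, le_refl]

lemma Ksum_bound (hq : 3 ≤ Fintype.card F) (χ : AddChar F ℂ) (hχ : χ ≠ 1) (a b : F) (ha : a ≠ 0) (s : ℕ) :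
    ‖Ksum F K χ a b (2 * s + 2)‖ ≤ 9 * (Fintype.card F : ℝ) ^ (s + 2) + 1 := by
  classical
  set q := Fintype.card F with hqd
  set k := 2 * s + 2 with hk
  have hk0 : 0 < k := by omega
  have hintg : ∀ x : K, IsIntegral F x := fun x => Algebra.IsIntegral.isIntegral x
  have hfix : ∀ x : K, x ∈ FixPts F K k ↔ x ^ (q ^ k) = x := fun x => mem_FixPts hk0
  set S : F → Finset K := fun c => ((FixPts F K k).erase 0).filter fun x => trE F a b k x = algebraMap F K c with hS
  have h1 : Ksum F K χ a b k = ∑ c, (((S c).card : ℝ) : ℂ) * χ c := by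
    have e : ∀ c, (((S c).card : ℝ) : ℂ) * χ c = ∑ x ∈ (FixPts F K k).erase 0,
        if trE F a b k x = algebraMap F K c then χ c else 0 := by
      intro c
      rw [← sum_filter, sum_const, nsmul_eq_mul]
      simp [hS]
    simp only [e]
    rw [sum_comm]
    have z : (0 : K) ∈ FixPts F K k := by
      rw [hfix, zero_pow (pow_pos (by omega) _).ne']
    unfold Ksum
    rw [← add_sum_erase _ _ z, psi_chp_zero χ a b k hk0, zero_add]
    refine sum_congr rfl fun x hx => ?_
    rw [mem_erase, hfix] at hx
    obtain ⟨c, hc⟩ := trE_mem a b k x hx.2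
    rw [psi_chp χ a b x (hintg x) hx.1 k hx.2 c hc.symm]
    simp only [← hc, (algebraMap F K).injective.eq_iff]
    simp
  have h2 : ∀ c, ((S c).card : ℝ) ≤ ((q ^ s + 9) * q ^ (s + 1) : ℕ) := by
    intro c
    rw [Nat.cast_le]
    refine stepanov_count q s rfl hq a b c ha (S c) ?_
    intro x hx
    rw [hS, mem_filter, mem_erase, hfix] at hx
    exact ⟨hx.1.1, hx.1.2, hx.2⟩
  have h3 : ∑ c, ((S c).card : ℝ) = (q : ℝ) ^ k - 1 := by
    have e : ∑ c, (S c).card = ((FixPts F K k).erase 0).card := by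
      rw [hS]
      simp only [card_filter]
      rw [sum_comm, card_eq_sum_ones]
      refine sum_congr rfl fun x hx => ?_
      rw [mem_erase, hfix] at hx
      obtain ⟨c, hc⟩ := trE_mem a b k x hx.2
      simp only [← hc, (algebraMap F K).injective.eq_iff]
      simp
    have z : (0 : K) ∈ FixPts F K k := by
      rw [hfix, zero_pow (pow_pos (by omega) _).ne']
    have e2 := card_erase_add_one z
    rw [← e, card_FixPts K k hk0] at e2
    have e3 : (∑ c, ((S c).card : ℝ)) + 1 = (q : ℝ) ^ k := by exact_mod_cast e2
    linarith
  have h4 := charsum_bound χ hχ (fun c => ((S c).card : ℝ)) _ h2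
  rw [← h1, h3] at h4
  refine h4.trans (le_of_eq ?_)
  push_cast
  rw [hk, ← hqd]
  ring

/-- growth contradiction -/
lemma growth_aux (w1 w2 q : ℝ) (hq : 1 ≤ q) (hw2 : 0 ≤ w2) (hw : w2 ≤ w1) (h1 : w1 ^ 2 > q) (C : ℝ)
    (h : ∀ s : ℕ, w1 ^ (2 * s + 2) ≤ w2 ^ (2 * s + 2) + C * q ^ s) (h2 : w2 ^ 2 ≤ q) : False := by
  have hq0 : 0 < q := by linarith
  set r := w1 ^ 2 / q with hr
  have hr1 : 1 < r := by rw [hr, lt_div_iff₀ hq0]; linarith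
  obtain ⟨s, hs⟩ := pow_unbounded_of_one_lt (1 + C) hr1
  have hh := h s
  have hqs : 0 < q ^ s := pow_pos hq0 s
  have e1 : w1 ^ (2 * s + 2) = r ^ s * q ^ s * w1 ^ 2 := by
    rw [← mul_pow, hr, div_mul_cancel₀ _ hq0.ne', ← pow_mul, ← pow_add]
  have e2 : w2 ^ (2 * s + 2) ≤ q ^ s * q := by
    rw [pow_add, pow_mul]
    exact mul_le_mul (pow_le_pow_left₀ (sq_nonneg _) h2 s) h2 (sq_nonneg _) hqs.le
  have h3 : r ^ s * q ^ s * w1 ^ 2 ≤ q ^ s * q + C * q ^ s := by linarith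
  have h4 : r ^ s * w1 ^ 2 ≤ q + C := by
    have : q ^ s * (r ^ s * w1 ^ 2) ≤ q ^ s * (q + C) := by linarith
    exact le_of_mul_le_mul_left this hqs
  have hrs : 1 ≤ r ^ s := one_le_pow₀ hr1.le
  have hC : 0 ≤ C ∨ C < 0 := le_or_gt 0 C
  rcases hC with hC | hC
  · nlinarith
  · nlinarith

lemma klo_bound (hq : 3 ≤ Fintype.card F) (χ : AddChar F ℂ) (hχ : χ ≠ 1) (a b : F) (ha : a ≠ 0) (hb : b ≠ 0) :
    ‖klo χ a b‖ ≤ 2 * Real.sqrt (Fintype.card F) := by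
  obtain ⟨h1, h2, h3⟩ := Ksum_rec (AlgebraicClosure F) χ hχ a b ha hb
  have hbd := Ksum_bound (AlgebraicClosure F) hq χ hχ a b ha
  set q : ℝ := ((Fintype.card F : ℕ) : ℝ) with hqd
  have hq1 : 3 ≤ q := by rw [hqd]; exact_mod_cast hq
  set κ := klo χ a b with hκ
  obtain ⟨δ, hδ⟩ := IsAlgClosed.exists_pow_nat_eq (κ ^ 2 - 4 * q : ℂ) (n := 2) two_pos
  set u := (-κ + δ) / 2 with hu
  set v := (-κ - δ) / 2 with hv
  have huv : u * v = q := by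
    rw [hu, hv]; linear_combination (-1/4 : ℂ) * hδ
  have hsum : u + v = -κ := by rw [hu, hv]; ring
  have hu2 : u ^ 2 = -κ * u - q := by linear_combination u * hsum - huv
  have hv2 : v ^ 2 = -κ * v - q := by linear_combination v * hsum - huv
  have hform : ∀ n, Ksum F (AlgebraicClosure F) χ a b (n + 1) = -(u ^ (n + 1) + v ^ (n + 1)) ∧
      Ksum F (AlgebraicClosure F) χ a b (n + 2) = -(u ^ (n + 2) + v ^ (n + 2)) := by
    intro n
    induction n with
    | zero =>
      refine ⟨by rw [h1]; linear_combination -hsum, ?_⟩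
      rw [h2]
      have : (Fintype.card F : ℂ) = (q : ℂ) := by rw [hqd]; simp
      rw [this]
      linear_combination (u + v - κ) * hsum - 2 * huv
    | succ n ih =>
      refine ⟨ih.2, ?_⟩
      rw [h3 n, ih.1, ih.2]
      have : (Fintype.card F : ℂ) = (q : ℂ) := by rw [hqd]; simp
      rw [this]
      linear_combination u ^ (n + 1) * hu2 + v ^ (n + 1) * hv2
  have hnuv : ‖u‖ * ‖v‖ = q := by rw [← norm_mul, huv, Complex.norm_real, Real.norm_of_nonneg (by linarith)]
  have hineq : ∀ s : ℕ, ‖u ^ (2 * s + 2) + v ^ (2 * s + 2)‖ ≤ (9 * q ^ 2 + 1) * q ^ s := by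
    intro s
    have := hbd s
    rw [(hform (2 * s)).2, norm_neg] at this
    refine this.trans ?_
    have h1 : 1 ≤ q ^ s := one_le_pow₀ (by linarith)
    rw [pow_add]; nlinarith
  have key : ∀ u v : ℂ, ‖u‖ * ‖v‖ = q → (∀ s : ℕ, ‖u ^ (2 * s + 2) + v ^ (2 * s + 2)‖ ≤ (9 * q ^ 2 + 1) * q ^ s) →
      ‖u‖ ^ 2 ≤ q := by
    intro u v h hi
    by_contra hc
    push Not at hc
    have hv2 : ‖v‖ ^ 2 ≤ q := by
      have : ‖u‖ ^ 2 * ‖v‖ ^ 2 = q * q := by rw [← mul_pow, h]; ring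
      nlinarith [sq_nonneg ‖v‖]
    refine growth_aux ‖u‖ ‖v‖ q (by linarith) (norm_nonneg _) ?_ hc (9 * q ^ 2 + 1) ?_ hv2
    · exact le_of_sq_le_sq (by linarith) (norm_nonneg _)
    · intro s
      have := norm_sub_le (u ^ (2 * s + 2) + v ^ (2 * s + 2)) (v ^ (2 * s + 2))
      rw [add_sub_cancel_right, norm_pow, norm_pow] at this
      linarith [hi s]
  have hu3 := key u v hnuv hineq
  have hv3 := key v u (by rw [mul_comm]; exact hnuv) (fun s => by rw [add_comm]; exact hineq s)
  have : κ = -(u + v) := by rw [hsum]; ring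
  rw [this, norm_neg]
  refine (norm_add_le _ _).trans ?_
  have := Real.le_sqrt_of_sq_le hu3
  have := Real.le_sqrt_of_sq_le hv3
  linarith

end KloostermanBound

section Salie

variable {F : Type*} [Field F] [Fintype F] [DecidableEq F]

/-- Complex valued quadratic character. -/
noncomputable def eta (s : F) : ℂ := ((quadraticChar F s : ℤ) : ℂ)

lemma eta_mul (s t : F) : eta (s * t) = eta s * eta t := by
  unfold eta
  rw [map_mul]
  push_cast
  rfl

lemma eta_sq (s : F) (hs : s ≠ 0) : eta s ^ 2 = 1 := by
  unfold eta; exact_mod_cast quadraticChar_sq_one hs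

lemma eta_norm (s : F) (hs : s ≠ 0) : ‖eta s‖ = 1 := by
  have := congrArg norm (eta_sq s hs)
  rw [norm_pow, norm_one] at this
  exact (pow_eq_one_iff_of_nonneg (norm_nonneg _) two_ne_zero).1 this

lemma eta_inv (s : F) (hs : s ≠ 0) : eta s⁻¹ = eta s := by
  have h1 : eta s⁻¹ * eta s = 1 := by rw [← eta_mul, inv_mul_cancel₀ hs]; simp [eta]
  have h2 := eta_sq s hs
  linear_combination eta s * h1 - eta s⁻¹ * h2

/-- quadratic Gauss sum -/
noncomputable def gs (χ : AddChar F ℂ) (s : F) : ℂ := ∑ x : F, χ (s * x ^ 2)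

lemma sum_char_zero (χ : AddChar F ℂ) (hχ : χ ≠ 1) : ∑ c, χ c = 0 := by
  rw [AddChar.sum_eq_zero_iff_ne_zero]
  exact hχ

lemma sum_char_mul (χ : AddChar F ℂ) (hχ : χ ≠ 1) (b : F) :
    ∑ x, χ (x * b) = if b = 0 then (Fintype.card F : ℂ) else 0 := by
  rw [AddChar.sum_mulShift b (AddChar.IsPrimitive.of_ne_one hχ)]
  split_ifs <;> simp

lemma gs_eq_sum (h2 : ringChar F ≠ 2) (χ : AddChar F ℂ) (hχ : χ ≠ 1) (s : F) (hs : s ≠ 0) :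
    gs χ s = ∑ y, eta y * χ (s * y) := by
  have h1 : gs χ s = ∑ y, (eta y + 1) * χ (s * y) := by
    unfold gs
    have : ∀ y : F, (eta y + 1) * χ (s * y) = ∑ x : F, if x ^ 2 = y then χ (s * y) else 0 := by
      intro y
      rw [← sum_filter, sum_const, nsmul_eq_mul]
      congr 1
      have := quadraticChar_card_sqrts h2 y
      unfold eta
      have h3 : (({x : F | x ^ 2 = y} : Set F).toFinset) = univ.filter fun x => x ^ 2 = y := by
        ext; simp
      rw [h3] at this
      exact_mod_cast this.symm
    simp only [this]
    rw [sum_comm]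
    simp
  rw [h1]
  simp only [add_mul, one_mul, sum_add_distrib]
  have : ∑ y, χ (s * y) = 0 := by
    have := sum_char_mul χ hχ s
    simp only [hs, if_false] at this
    simpa [mul_comm] using this
  rw [this, add_zero]

lemma gs_eta (h2 : ringChar F ≠ 2) (χ : AddChar F ℂ) (hχ : χ ≠ 1) (s : F) (hs : s ≠ 0) :
    gs χ s = eta s * gs χ 1 := by
  rw [gs_eq_sum h2 χ hχ s hs, gs_eq_sum h2 χ hχ 1 one_ne_zero, mul_sum]
  refine Fintype.sum_equiv (Equiv.mulLeft₀ s hs) _ _ ?_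
  intro y
  simp only [Equiv.mulLeft₀_apply, one_mul, eta_mul]
  rw [← mul_assoc, ← mul_assoc, ← sq, eta_sq s hs, one_mul]

lemma gs_one_norm (h2 : ringChar F ≠ 2) (χ : AddChar F ℂ) (hχ : χ ≠ 1) :
    ‖gs χ 1‖ = Real.sqrt (Fintype.card F) := by
  set η : MulChar F ℂ := (quadraticChar F).ringHomComp (Int.castRingHom ℂ) with hη
  have h1 : gs χ 1 = gaussSum η χ := by
    rw [gs_eq_sum h2 χ hχ 1 one_ne_zero]
    unfold gaussSum
    refine sum_congr rfl fun y _ => ?_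
    rw [one_mul]
    rfl
  have hq : η.IsQuadratic := (quadraticChar_isQuadratic F).comp _
  have hne : η ≠ 1 := by
    rw [hη, Ne, MulChar.ringHomComp_eq_one_iff (RingHom.injective_int _)]
    exact quadraticChar_ne_one h2
  have h3 := congrArg norm (gaussSum_sq hne hq (AddChar.IsPrimitive.of_ne_one hχ))
  have h4 : ‖η (-1)‖ = 1 := eta_norm (-1 : F) (neg_ne_zero.2 one_ne_zero)
  rw [norm_pow, norm_mul, h4, one_mul, ← h1, Complex.norm_natCast] at h3
  rw [← h3, Real.sqrt_sq (norm_nonneg _)]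

lemma gs_norm (h2 : ringChar F ≠ 2) (χ : AddChar F ℂ) (hχ : χ ≠ 1) (s : F) (hs : s ≠ 0) :
    ‖gs χ s‖ = Real.sqrt (Fintype.card F) := by
  rw [gs_eta h2 χ hχ s hs, norm_mul, eta_norm s hs, one_mul, gs_one_norm h2 χ hχ]

lemma two_ne (h2 : ringChar F ≠ 2) : (2 : F) ≠ 0 := Ring.two_ne_zero h2

lemma quad_complete (h2 : ringChar F ≠ 2) (χ : AddChar F ℂ) (s x : F) (hs : s ≠ 0) :
    ∑ z, χ (s * z ^ 2 + x * z) = χ (-(x ^ 2 / 4) * s⁻¹) * gs χ s := by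
  have h2' := two_ne h2
  unfold gs
  rw [mul_sum]
  refine Fintype.sum_equiv (Equiv.addRight (x / (2 * s))) _ _ ?_
  intro z
  rw [← AddChar.map_add_eq_mul]
  congr 1
  simp only [Equiv.coe_addRight]
  have h4 : (4 : F) ≠ 0 := by
    have : (4 : F) = 2 * 2 := by norm_num
    rw [this]; exact mul_ne_zero h2' h2'
  field_simp
  ring

/-- twisted Kloosterman sums -/
noncomputable def twk (χ : AddChar F ℂ) (e : ℕ) (a b : F) : ℂ :=
  ∑ s : F, if s = 0 then 0 else eta s ^ e * χ (a * s + b * s⁻¹)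

lemma salie_norm_aux (h2 : ringChar F ≠ 2) (χ : AddChar F ℂ) (hχ : χ ≠ 1) (D : F) :
    ‖twk χ 1 (-D) (-(1 / 4))‖ ≤ 2 * Real.sqrt (Fintype.card F) := by
  have hq0 : (0 : ℝ) < Fintype.card F := by exact_mod_cast Fintype.card_pos
  have key : (Fintype.card F : ℂ) * ∑ v ∈ univ.filter (fun v : F => v ^ 2 = D), χ v
      = gs χ 1 * twk χ 1 (-D) (-(1 / 4)) := by
    have e1 : (Fintype.card F : ℂ) * ∑ v ∈ univ.filter (fun v : F => v ^ 2 = D), χ v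
        = ∑ v, ∑ s, χ (s * (v ^ 2 - D)) * χ v := by
      rw [mul_sum, sum_filter]
      refine sum_congr rfl fun v _ => ?_
      rw [← sum_mul, sum_char_mul χ hχ]
      simp only [sub_eq_zero]
      split_ifs <;> simp
    rw [e1, sum_comm]
    unfold twk
    rw [mul_sum]
    refine sum_congr rfl fun s _ => ?_
    by_cases hs : s = 0
    · simp [hs, sum_char_zero χ hχ]
    · rw [if_neg hs]
      have e2 : ∀ v, χ (s * (v ^ 2 - D)) * χ v = χ (-D * s) * χ (s * v ^ 2 + 1 * v) := by
        intro v
        rw [← AddChar.map_add_eq_mul, ← AddChar.map_add_eq_mul]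
        congr 1
        ring
      simp only [e2]
      rw [← mul_sum, quad_complete h2 χ s 1 hs, gs_eta h2 χ hχ s hs, AddChar.map_add_eq_mul]
      simp only [one_pow, pow_one]
      ring
  have h3 := congrArg norm key
  rw [norm_mul, norm_mul, gs_one_norm h2 χ hχ, Complex.norm_natCast] at h3
  have h4 : ‖∑ v ∈ univ.filter (fun v : F => v ^ 2 = D), χ v‖ ≤ 2 := by
    refine (norm_sum_le _ _).trans ?_
    simp only [AddChar.norm_apply, sum_const, nsmul_eq_mul, mul_one]
    have := quadraticChar_card_sqrts h2 D
    have h3 : (({x : F | x ^ 2 = D} : Set F).toFinset) = univ.filter fun x => x ^ 2 = D := by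
      ext; simp
    rw [h3] at this
    have h5 : quadraticChar F D ≤ 1 := by
      by_cases hD : D = 0
      · simp [hD]
      · rcases quadraticChar_dichotomy hD with h | h <;> rw [h]; norm_num
    have h6 : ((univ.filter fun x : F => x ^ 2 = D).card : ℤ) ≤ 2 := by omega
    exact_mod_cast h6
  have hs : Real.sqrt (Fintype.card F) * Real.sqrt (Fintype.card F) = Fintype.card F :=
    Real.mul_self_sqrt hq0.le
  have hsp : 0 < Real.sqrt (Fintype.card F) := Real.sqrt_pos.2 hq0
  have : Real.sqrt (Fintype.card F) * ‖twk χ 1 (-D) (-(1 / 4))‖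
     ≤ Real.sqrt (Fintype.card F) * (2 * Real.sqrt (Fintype.card F)) := by
    rw [← h3]
    nlinarith
  exact le_of_mul_le_mul_left this hsp

lemma salie_bound (h2 : ringChar F ≠ 2) (χ : AddChar F ℂ) (hχ : χ ≠ 1) (a b : F) (ha : a ≠ 0) :
    ‖twk χ 1 a b‖ ≤ 2 * Real.sqrt (Fintype.card F) := by
  have h2' := two_ne h2
  have h4 : (4 : F) ≠ 0 := by
    have : (4 : F) = 2 * 2 := by norm_num
    rw [this]; exact mul_ne_zero h2' h2'
  have hc : -(4 * a) ≠ 0 := neg_ne_zero.2 (mul_ne_zero h4 ha)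
  have h : twk χ 1 a b = eta (-(4 * a)) * twk χ 1 (-(4 * a * b)) (-(1 / 4)) := by
    unfold twk
    rw [mul_sum]
    refine Fintype.sum_equiv ((Function.Involutive.toPerm (fun x : F => x⁻¹) inv_involutive).trans (Equiv.mulLeft₀ (-(4 * a))⁻¹ (inv_ne_zero hc))) _ _ ?_
    intro s
    simp only [Equiv.trans_apply, Equiv.mulLeft₀_apply, Function.Involutive.coe_toPerm, pow_one]
    by_cases hs : s = 0
    · simp [hs]
    · rw [if_neg hs, if_neg (mul_ne_zero (inv_ne_zero hc) (inv_ne_zero hs)), eta_mul, eta_inv _ hc,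
        eta_inv _ hs, ← mul_assoc, ← mul_assoc, ← sq, eta_sq _ hc, one_mul]
      congr 2
      field_simp
      ring
  rw [h, norm_mul, eta_norm _ hc, one_mul]
  exact salie_norm_aux h2 χ hχ _

lemma twk_bound (h2 : ringChar F ≠ 2) (hq : 3 ≤ Fintype.card F) (χ : AddChar F ℂ) (hχ : χ ≠ 1) (e : ℕ)
    (a b : F) (ha : a ≠ 0) : ‖twk χ e a b‖ ≤ 2 * Real.sqrt (Fintype.card F) := by
  have hs1 : 1 ≤ Real.sqrt (Fintype.card F) := by
    rw [Real.one_le_sqrt]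
    exact_mod_cast (by omega : 1 ≤ Fintype.card F)
  rcases Nat.even_or_odd' e with ⟨k, rfl | rfl⟩
  · have h : twk χ (2 * k) a b = klo χ a b := by
      unfold twk klo
      refine sum_congr rfl fun s _ => ?_
      by_cases hs : s = 0
      · simp [hs]
      · rw [if_neg hs, if_neg hs, pow_mul, eta_sq s hs, one_pow, one_mul]
    rw [h]
    by_cases hb : b = 0
    · have : klo χ a b = -1 := by
        unfold klo
        have e1 : ∀ x : F, (if x = 0 then 0 else χ (a * x + b * x⁻¹)) = χ (x * a) - if x = 0 then 1 else 0 := by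
          intro x
          by_cases hx : x = 0
          · simp [hx]
          · simp [hx, hb, mul_comm]
        have e2 := sum_char_mul χ hχ a
        rw [if_neg ha] at e2
        have e3 : ∑ x : F, ((χ (x * a) : ℂ) - if x = 0 then 1 else 0) = -1 := by
          rw [sum_sub_distrib, e2]; simp
        rw [← e3]
        refine sum_congr rfl fun x _ => ?_
        rw [← e1]
        congr
      rw [this, norm_neg, norm_one]
      linarith
    · exact klo_bound hq χ hχ a b ha hb
  · have h : twk χ (2 * k + 1) a b = twk χ 1 a b := by
      unfold twk
      refine sum_congr rfl fun s _ => ?_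
      by_cases hs : s = 0
      · simp [hs]
      · rw [if_neg hs, if_neg hs, pow_succ, pow_mul, eta_sq s hs, one_pow, one_mul, pow_one]
    rw [h]
    exact salie_bound h2 χ hχ a b ha

end Salie

section Spectral

variable {F : Type*} [Field F] [Fintype F] [DecidableEq F]

lemma achar_map_sum {ι : Type*} (χ : AddChar F ℂ) (s : Finset ι) (f : ι → F) :
    χ (∑ i ∈ s, f i) = ∏ i ∈ s, χ (f i) := by
  classical
  induction s using Finset.induction_on with
  | empty => simp
  | insert a s ha ih => rw [sum_insert ha, prod_insert ha, AddChar.map_add_eq_mul, ih]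

/-- dot character -/
noncomputable def dch {D : ℕ} (χ : AddChar F ℂ) (ξ x : Fin D → F) : ℂ := ∏ i, χ (ξ i * x i)

lemma sum_prod_pi {D : ℕ} (f : Fin D → F → ℂ) :
    ∑ x : Fin D → F, ∏ i, f i (x i) = ∏ i, ∑ t, f i t := by
  rw [Finset.prod_univ_sum, Fintype.piFinset_univ]

lemma dch_orth {D : ℕ} (χ : AddChar F ℂ) (hχ : χ ≠ 1) (x : Fin D → F) :
    ∑ ξ, dch χ ξ x = if x = 0 then (Fintype.card F : ℂ) ^ D else 0 := by
  unfold dch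
  rw [sum_prod_pi (fun i t => χ (t * x i))]
  simp only [sum_char_mul χ hχ]
  split_ifs with h
  · simp [h]
  · obtain ⟨i, hi⟩ := Function.ne_iff.1 h
    exact prod_eq_zero (mem_univ i) (if_neg hi)

lemma dch_add {D : ℕ} (χ : AddChar F ℂ) (ξ x y : Fin D → F) :
    dch χ ξ (x + y) = dch χ ξ x * dch χ ξ y := by
  unfold dch
  rw [← prod_mul_distrib]
  refine prod_congr rfl fun i _ => ?_
  rw [← AddChar.map_add_eq_mul, Pi.add_apply, mul_add]

lemma dch_neg_right {D : ℕ} (χ : AddChar F ℂ) (ξ x : Fin D → F) :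
    dch χ ξ (-x) = dch χ (-ξ) x := by
  simp [dch]

lemma dch_conj {D : ℕ} (χ : AddChar F ℂ) (ξ x : Fin D → F) :
    (starRingEnd ℂ) (dch χ ξ x) = dch χ ξ (-x) := by
  unfold dch
  rw [map_prod]
  refine prod_congr rfl fun i _ => ?_
  rw [← AddChar.map_neg_eq_conj, Pi.neg_apply, mul_neg]

/-- Fourier transform -/
noncomputable def ft {D : ℕ} (χ : AddChar F ℂ) (f : (Fin D → F) → ℂ) (ξ : Fin D → F) : ℂ :=
  ∑ x, f x * dch χ ξ x

lemma parseval {D : ℕ} (χ : AddChar F ℂ) (hχ : χ ≠ 1) (f : (Fin D → F) → ℝ) :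
    ∑ ξ, ‖ft χ (fun x => (f x : ℂ)) ξ‖ ^ 2 = (Fintype.card F : ℝ) ^ D * ∑ x, f x ^ 2 := by
  have h : ∀ ξ, ((‖ft χ (fun x => (f x : ℂ)) ξ‖ ^ 2 : ℝ) : ℂ)
      = ∑ x, ∑ y, (f x : ℂ) * f y * dch χ ξ (x - y) := by
    intro ξ
    push_cast
    rw [← Complex.mul_conj']
    unfold ft
    rw [map_sum, sum_mul_sum]
    refine sum_congr rfl fun x _ => sum_congr rfl fun y _ => ?_
    rw [map_mul, Complex.conj_ofReal, dch_conj, sub_eq_add_neg, dch_add]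
    ring
  have h2 : ((∑ ξ, ‖ft χ (fun x => (f x : ℂ)) ξ‖ ^ 2 : ℝ) : ℂ)
      = (((Fintype.card F : ℝ) ^ D * ∑ x, f x ^ 2 : ℝ) : ℂ) := by
    rw [Complex.ofReal_sum]
    simp only [h]
    rw [sum_comm]
    push_cast
    rw [mul_sum]
    refine sum_congr rfl fun x _ => ?_
    rw [sum_comm]
    simp only [← mul_sum, dch_orth χ hχ, sub_eq_zero]
    simp
    ring
  exact_mod_cast h2

lemma ft_inv {D : ℕ} (χ : AddChar F ℂ) (hχ : χ ≠ 1) (k : (Fin D → F) → ℂ) (z : Fin D → F) :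
    (Fintype.card F : ℂ) ^ D * k z = ∑ ξ, ft χ k ξ * dch χ ξ (-z) := by
  unfold ft
  simp only [sum_mul]
  rw [sum_comm]
  have : ∀ y, ∑ ξ, k y * dch χ ξ y * dch χ ξ (-z) = k y * if y = z then (Fintype.card F : ℂ) ^ D else 0 := by
    intro y
    have : ∀ ξ, k y * dch χ ξ y * dch χ ξ (-z) = k y * dch χ ξ (y - z) := by
      intro ξ
      rw [sub_eq_add_neg, dch_add]; ring
    simp only [this]
    rw [← mul_sum, dch_orth χ hχ]
    simp only [sub_eq_zero]
  simp only [this]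
  simp
  ring

lemma conv_bound {D : ℕ} (χ : AddChar F ℂ) (hχ : χ ≠ 1) (k : (Fin D → F) → ℝ) (M : ℝ)
    (hM : ∀ ξ, ‖ft χ (fun x => (k x : ℂ)) ξ‖ ≤ 2 * M) (f g : (Fin D → F) → ℝ) :
    |∑ u, ∑ v, f u * g v * k (u - v)| ≤ M * (∑ u, f u ^ 2 + ∑ v, g v ^ 2) := by
  have hq0 : (0 : ℝ) < (Fintype.card F : ℝ) ^ D := pow_pos (by exact_mod_cast Fintype.card_pos) _
  set S := ∑ u, ∑ v, f u * g v * k (u - v) with hS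
  have h1 : (Fintype.card F : ℂ) ^ D * (S : ℂ) = ∑ ξ, ft χ (fun x => (k x : ℂ)) ξ *
      (ft χ (fun x => (f x : ℂ)) (-ξ) * ft χ (fun x => (g x : ℂ)) ξ) := by
    have e1 : (Fintype.card F : ℂ) ^ D * (S : ℂ) = ∑ u, ∑ v, (f u : ℂ) * g v * ∑ ξ,
        ft χ (fun x => (k x : ℂ)) ξ * dch χ ξ (-(u - v)) := by
      rw [hS]
      push_cast
      rw [mul_sum]
      refine sum_congr rfl fun u _ => ?_
      rw [mul_sum]
      refine sum_congr rfl fun v _ => ?_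
      rw [← ft_inv χ hχ]
      ring
    rw [e1]
    have e2 : ∀ ξ, ft χ (fun x => (k x : ℂ)) ξ *
      (ft χ (fun x => (f x : ℂ)) (-ξ) * ft χ (fun x => (g x : ℂ)) ξ) = ∑ u, ∑ v, (f u : ℂ) * g v * (
        ft χ (fun x => (k x : ℂ)) ξ * dch χ ξ (-(u - v))) := by
      intro ξ
      conv_lhs => rw [ft.eq_def χ (fun x => (f x : ℂ)), ft.eq_def χ (fun x => (g x : ℂ))]
      rw [sum_mul_sum, mul_sum]
      refine sum_congr rfl fun u _ => ?_
      rw [mul_sum]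
      refine sum_congr rfl fun v _ => ?_
      rw [neg_sub, sub_eq_add_neg, dch_add, dch_neg_right]
      ring
    simp only [e2, mul_sum]
    conv_rhs => rw [sum_comm]
    refine sum_congr rfl fun u _ => ?_
    rw [sum_comm]
  have h2 := congrArg norm h1
  rw [norm_mul, norm_pow, Complex.norm_natCast, Complex.norm_real, Real.norm_eq_abs] at h2
  have h3 : (Fintype.card F : ℝ) ^ D * |S| ≤ (Fintype.card F : ℝ) ^ D * (M * (∑ u, f u ^ 2 + ∑ v, g v ^ 2)) := by
    rw [h2]
    refine (norm_sum_le _ _).trans ?_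
    have e3 : ∀ ξ ∈ (univ : Finset (Fin D → F)), ‖ft χ (fun x => (k x : ℂ)) ξ *
      (ft χ (fun x => (f x : ℂ)) (-ξ) * ft χ (fun x => (g x : ℂ)) ξ)‖ ≤
        M * (‖ft χ (fun x => (f x : ℂ)) (-ξ)‖ ^ 2 + ‖ft χ (fun x => (g x : ℂ)) ξ‖ ^ 2) := by
      intro ξ _
      rw [norm_mul, norm_mul]
      have := hM ξ
      have hM0 : 0 ≤ M := by linarith [norm_nonneg (ft χ (fun x => (k x : ℂ)) ξ)]
      set p := ‖ft χ (fun x => (f x : ℂ)) (-ξ)‖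
      set r := ‖ft χ (fun x => (g x : ℂ)) ξ‖
      have hp : 0 ≤ p := norm_nonneg _
      have hr : 0 ≤ r := norm_nonneg _
      have h5 := mul_le_mul_of_nonneg_right this (mul_nonneg hp hr)
      nlinarith [mul_nonneg hM0 (sq_nonneg (p - r))]
    refine (sum_le_sum e3).trans (le_of_eq ?_)
    rw [← mul_sum, sum_add_distrib, parseval χ hχ]
    have : ∑ ξ, ‖ft χ (fun x => (f x : ℂ)) (-ξ)‖ ^ 2 = ∑ ξ, ‖ft χ (fun x => (f x : ℂ)) ξ‖ ^ 2 :=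
      Fintype.sum_equiv (Equiv.neg _) _ _ fun _ => rfl
    rw [this, parseval χ hχ]
    ring
  exact le_of_mul_le_mul_left h3 hq0

lemma ft_kernel (h2 : ringChar F ≠ 2) (hq : 3 ≤ Fintype.card F) {D : ℕ} (χ : AddChar F ℂ) (hχ : χ ≠ 1)
    (w : Fin D → F) (hw : ∀ i, w i ≠ 0) (l : F) (hl : l ≠ 0) (ξ : Fin D → F) :
    ‖ft χ (fun z => (((if ∑ i, w i * z i ^ 2 = l then (Fintype.card F : ℝ) else 0) - 1 : ℝ) : ℂ)) ξ‖
      ≤ 2 * Real.sqrt (Fintype.card F) ^ (D + 1) := by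
  have hk : ∀ z : Fin D → F, (((if ∑ i, w i * z i ^ 2 = l then (Fintype.card F : ℝ) else 0) - 1 : ℝ) : ℂ)
      = ∑ s, if s = 0 then 0 else χ (s * (∑ i, w i * z i ^ 2 - l)) := by
    intro z
    have e := sum_char_mul χ hχ (∑ i, w i * z i ^ 2 - l)
    have e1 : ∀ s : F, (if s = 0 then 0 else χ (s * (∑ i, w i * z i ^ 2 - l))) =
        χ (s * (∑ i, w i * z i ^ 2 - l)) - if s = 0 then 1 else 0 := by
      intro s
      by_cases hs : s = 0
      · simp [hs]
      · simp [hs]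
    simp only [e1]
    rw [sum_sub_distrib, e]
    simp only [sub_eq_zero]
    split_ifs <;> simp
  have h : ft χ (fun z => (((if ∑ i, w i * z i ^ 2 = l then (Fintype.card F : ℝ) else 0) - 1 : ℝ) : ℂ)) ξ
      = (∏ i, gs χ (w i)) * twk χ D (-l) (∑ i, -(ξ i ^ 2 / 4) * (w i)⁻¹) := by
    unfold ft twk
    simp only [hk, sum_mul]
    rw [sum_comm, mul_sum]
    refine sum_congr rfl fun s _ => ?_
    by_cases hs : s = 0
    · simp [hs]
    · simp only [hs, if_false]
      have e1 : ∀ x : Fin D → F, χ (s * (∑ i, w i * x i ^ 2 - l)) * dch χ ξ x =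
          χ (-l * s) * ∏ i, χ (s * w i * x i ^ 2 + ξ i * x i) := by
        intro x
        unfold dch
        simp only [AddChar.map_add_eq_mul, prod_mul_distrib]
        rw [← achar_map_sum χ _ (fun i => s * w i * x i ^ 2), ← mul_assoc, ← AddChar.map_add_eq_mul]
        congr 2
        rw [mul_sub, mul_sum]
        simp only [mul_assoc]
        ring
      simp only [e1]
      rw [← mul_sum, sum_prod_pi (fun i t => χ (s * w i * t ^ 2 + ξ i * t))]
      have e2 : ∀ i, ∑ t, χ (s * w i * t ^ 2 + ξ i * t) =
          χ (-(ξ i ^ 2 / 4) * (w i)⁻¹ * s⁻¹) * (eta s * gs χ (w i)) := by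
        intro i
        rw [quad_complete h2 χ _ _ (mul_ne_zero hs (hw i)), gs_eta h2 χ hχ _ (mul_ne_zero hs (hw i)),
          gs_eta h2 χ hχ _ (hw i), eta_mul, mul_inv, mul_assoc (-(ξ i ^ 2 / 4)), mul_comm s⁻¹]
        ring
      simp only [e2, prod_mul_distrib]
      rw [← achar_map_sum, ← sum_mul, AddChar.map_add_eq_mul]
      simp
      ring
  rw [h, norm_mul, norm_prod]
  simp only [gs_norm h2 χ hχ _ (hw _)]
  rw [prod_const, card_univ, Fintype.card_fin, pow_succ]
  have := twk_bound h2 hq χ hχ D (-l) (∑ i, -(ξ i ^ 2 / 4) * (w i)⁻¹) (neg_ne_zero.2 hl)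
  have h5 := mul_le_mul_of_nonneg_left this (pow_nonneg (Real.sqrt_nonneg (Fintype.card F)) D)
  linarith

theorem spectral (hodd : Odd (Fintype.card F)) {d : ℕ} (Q : QuadraticForm F (Fin d → F))
    (hQ : ∀ x, (∀ y, QuadraticMap.polar (⇑Q) x y = 0) → x = 0) (l : F) (hl : l ≠ 0)
    (f g : (Fin d → F) → ℝ) :
    |∑ u, ∑ v, f u * g v * ((if Q (u - v) = l then (Fintype.card F : ℝ) else 0) - 1)| ≤
      Real.sqrt (Fintype.card F) ^ (d + 1) * (∑ u, f u ^ 2 + ∑ v, g v ^ 2) := by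
  have h2 : ringChar F ≠ 2 := by
    intro h
    rw [FiniteField.even_card_iff_char_two] at h
    rcases hodd with ⟨k, hk⟩
    omega
  have hq : 3 ≤ Fintype.card F := by
    have : 1 < Fintype.card F := Fintype.one_lt_card
    rcases hodd with ⟨k, hk⟩
    omega
  obtain ⟨χ, hχ⟩ : ∃ χ : AddChar F ℂ, χ ≠ 1 := by
    obtain ⟨χ, hχ⟩ := (AddChar.exists_apply_ne_zero (a := (1 : F))).2 one_ne_zero
    exact ⟨χ, fun h => hχ (by rw [h]; rfl)⟩
  letI : Invertible (2 : F) := invertibleOfNonzero (two_ne h2)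
  have hsep : LinearMap.SeparatingLeft (QuadraticMap.associated Q) := by
    intro x hx
    refine hQ x fun y => ?_
    have := hx y
    have h3 := LinearMap.congr_fun (LinearMap.congr_fun (QuadraticMap.two_nsmul_associated F Q) x) y
    rw [LinearMap.smul_apply, LinearMap.smul_apply, this, smul_zero] at h3
    exact h3.symm
  obtain ⟨D, hD, w, ⟨e⟩⟩ : ∃ D, D = d ∧ ∃ w : Fin D → Fˣ,
      QuadraticMap.Equivalent Q (QuadraticMap.weightedSumSquares F w) :=
    ⟨_, by simp, QuadraticForm.equivalent_weightedSumSquares_units_of_nondegenerate' Q hsep⟩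
  subst hD
  have hQe : ∀ z, Q z = ∑ i, (w i : F) * (e z) i ^ 2 := by
    intro z
    rw [← e.map_app, QuadraticMap.weightedSumSquares_apply]
    refine sum_congr rfl fun i _ => ?_
    rw [sq]
    rfl
  have hb := conv_bound χ hχ (fun z : Fin D → F => (if ∑ i, (w i : F) * z i ^ 2 = l then (Fintype.card F : ℝ) else 0) - 1)
    (Real.sqrt (Fintype.card F) ^ (D + 1))
    (fun ξ => ft_kernel h2 hq χ hχ (fun i => (w i : F)) (fun i => (w i).ne_zero) l hl ξ)
    (fun z => f (e.toLinearEquiv.symm z)) (fun z => g (e.toLinearEquiv.symm z))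
  have t1 : ∀ h : (Fin D → F) → ℝ, ∑ z : Fin D → F, h (e.toLinearEquiv.symm z) = ∑ u, h u := fun h =>
    Fintype.sum_equiv e.toLinearEquiv.symm.toEquiv _ _ fun _ => rfl
  rw [t1 (fun u => f u ^ 2), t1 (fun u => g u ^ 2)] at hb
  refine le_trans (le_of_eq ?_) hb
  congr 1
  refine (Fintype.sum_equiv e.toLinearEquiv.toEquiv _ _ fun u => ?_)
  refine (Fintype.sum_equiv e.toLinearEquiv.toEquiv _ _ fun v => ?_)
  simp only [hQe]
  simp

end Spectral

section Comb

variable {V : Type*} [Fintype V] [DecidableEq V] {n : ℕ}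

lemma sum_update_avg (i : Fin n) (H : (Fin n → V) → ℝ) :
    ∑ x, ∑ u, H (Function.update x i u) = (Fintype.card V : ℝ) * ∑ x, H x := by
  have h1 : ∑ x, ∑ u, H (Function.update x i u) = ∑ p : (Fin n → V) × V, H (Function.update p.1 i p.2) := by
    rw [Fintype.sum_prod_type]
  have h2 : ∑ p : (Fin n → V) × V, H (Function.update p.1 i p.2) = ∑ p : (Fin n → V) × V, H p.1 := by
    have hinv : Function.Involutive (fun p : (Fin n → V) × V => (Function.update p.1 i p.2, p.1 i)) := by
      intro p
      simp
    exact Fintype.sum_equiv hinv.toPerm _ _ fun _ => rfl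
  rw [h1, h2, Fintype.sum_prod_type]
  simp [mul_sum]

/-- indicator -/
def ind (A : Finset V) (v : V) : ℝ := if v ∈ A then 1 else 0

lemma ind_nonneg (A : Finset V) (v : V) : 0 ≤ ind A v := by unfold ind; split_ifs <;> norm_num
lemma ind_le (A : Finset V) (v : V) : ind A v ≤ 1 := by unfold ind; split_ifs <;> norm_num

/-- weight of an embedding -/
def Wt (A : Finset V) (σ : Fin n × Fin n → V → V → ℝ) (E : Finset (Fin n × Fin n)) (x : Fin n → V) : ℝ :=
  (∏ k, ind A (x k)) * ∏ e ∈ E, σ e (x e.1) (x e.2)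

/-- edge touches vertex -/
def tch (e : Fin n × Fin n) (i : Fin n) : Prop := e.1 = i ∨ e.2 = i

instance (e : Fin n × Fin n) (i : Fin n) : Decidable (tch e i) := by unfold tch; infer_instance

lemma step_bound (A : Finset V) (σ : Fin n × Fin n → V → V → ℝ) (q : ℝ) (hq : 1 ≤ q)
    (hσ0 : ∀ e u v, 0 ≤ σ e u v) (hσq : ∀ e u v, σ e u v ≤ q) (B : ℝ) (hB0 : 0 < B)
    (E : Finset (Fin n × Fin n)) (hlt : ∀ e ∈ E, e.1 < e.2) (i j : Fin n) (hij : i < j)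
    (hE : (i, j) ∉ E)
    (hB : ∀ f g : V → ℝ, |∑ u, ∑ v, f u * g v * (σ (i, j) u v - 1)| ≤ B * (∑ u, f u ^ 2 + ∑ v, g v ^ 2))
    (t : ℕ) (hti : (E.filter fun e => tch e i).card ≤ t) (htj : (E.filter fun e => tch e j).card ≤ t) :
    (A.card : ℝ) * |∑ x, Wt A σ (insert (i, j) E) x - ∑ x, Wt A σ E x| ≤
      q ^ t * B * (∑ x, Wt A σ (E.filter fun e => ¬ tch e j) x + ∑ x, Wt A σ (E.filter fun e => ¬ tch e i) x) := by
  have hne : i ≠ j := hij.ne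
  have hboth : ∀ e ∈ E, ¬ (tch e i ∧ tch e j) := by
    rintro ⟨e1, e2⟩ he ⟨h1, h2⟩
    have := hlt _ he
    unfold tch at h1 h2
    simp only at h1 h2 this
    have h3 : (e1 = i ∧ e2 = j) := by
      rcases h1 with h1 | h1 <;> rcases h2 with h2 | h2
      · exact absurd (h1.symm.trans h2) hne
      · exact ⟨h1, h2⟩
      · rw [h1, h2] at this
        exact absurd hij this.asymm
      · exact absurd (h1.symm.trans h2) hne
    rw [h3.1, h3.2] at he
    exact hE he
  set s : Fin n × Fin n → (Fin n → V) → ℝ := fun e x => σ e (x e.1) (x e.2) with hs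
  have hs0 : ∀ e x, 0 ≤ s e x := fun e x => hσ0 _ _ _
  have hsu : ∀ e x k u, ¬ tch e k → s e (Function.update x k u) = s e x := by
    intro e x k u hk
    unfold tch at hk
    push Not at hk
    simp only [hs]
    rw [Function.update_of_ne hk.1, Function.update_of_ne hk.2]
  set R : (Fin n → V) → ℝ := fun x => (∏ k ∈ (univ.erase i).erase j, ind A (x k)) *
    ∏ e ∈ E, if ¬ tch e i ∧ ¬ tch e j then s e x else 1 with hR
  set f : (Fin n → V) → ℝ := fun x => ind A (x i) * ∏ e ∈ E, if tch e i then s e x else 1 with hf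
  set g : (Fin n → V) → ℝ := fun x => ind A (x j) * ∏ e ∈ E, if tch e j then s e x else 1 with hg
  have hI : ∀ x : Fin n → V, ∏ k, ind A (x k) = ind A (x i) * ind A (x j) * ∏ k ∈ (univ.erase i).erase j, ind A (x k) := by
    intro x
    rw [← mul_prod_erase univ _ (mem_univ i), ← mul_prod_erase (univ.erase i) _ (mem_erase.2 ⟨hne.symm, mem_univ j⟩)]
    ring
  have hW : ∀ x, Wt A σ E x = R x * f x * g x := by
    intro x
    simp only [Wt, hR, hf, hg]
    rw [hI]
    have : ∏ e ∈ E, σ e (x e.1) (x e.2) = (∏ e ∈ E, if ¬ tch e i ∧ ¬ tch e j then s e x else 1) *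
      (∏ e ∈ E, if tch e i then s e x else 1) * (∏ e ∈ E, if tch e j then s e x else 1) := by
      rw [← prod_mul_distrib, ← prod_mul_distrib]
      refine prod_congr rfl fun e he => ?_
      have := hboth e he
      by_cases h1 : tch e i <;> by_cases h2 : tch e j <;> simp_all
    rw [this]
    ring
  have hWj : ∀ x, Wt A σ (E.filter fun e => ¬ tch e j) x = R x * f x * ind A (x j) := by
    intro x
    simp only [Wt, hR, hf]
    rw [hI, prod_filter]
    have : (∏ e ∈ E, if ¬ tch e j then σ e (x e.1) (x e.2) else 1) = (∏ e ∈ E, if ¬ tch e i ∧ ¬ tch e j then s e x else 1) *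
      (∏ e ∈ E, if tch e i then s e x else 1) := by
      rw [← prod_mul_distrib]
      refine prod_congr rfl fun e he => ?_
      have := hboth e he
      by_cases h1 : tch e i <;> by_cases h2 : tch e j <;> simp_all
    rw [this]
    ring
  have hWi : ∀ x, Wt A σ (E.filter fun e => ¬ tch e i) x = R x * g x * ind A (x i) := by
    intro x
    simp only [Wt, hR, hg]
    rw [hI, prod_filter]
    have : (∏ e ∈ E, if ¬ tch e i then σ e (x e.1) (x e.2) else 1) = (∏ e ∈ E, if ¬ tch e i ∧ ¬ tch e j then s e x else 1) *
      (∏ e ∈ E, if tch e j then s e x else 1) := by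
      rw [← prod_mul_distrib]
      refine prod_congr rfl fun e he => ?_
      have := hboth e he
      by_cases h1 : tch e i <;> by_cases h2 : tch e j <;> simp_all
    rw [this]
    ring
  have hRi : ∀ x u, R (Function.update x i u) = R x := by
    intro x u
    simp only [hR]
    congr 1
    · refine prod_congr rfl fun k hk => ?_
      rw [mem_erase, mem_erase] at hk
      rw [Function.update_of_ne hk.2.1]
    · refine prod_congr rfl fun e _ => ?_
      split_ifs with h
      · exact hsu _ _ _ _ h.1
      · rfl
  have hRj : ∀ x u, R (Function.update x j u) = R x := by
    intro x u
    simp only [hR]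
    congr 1
    · refine prod_congr rfl fun k hk => ?_
      rw [mem_erase, mem_erase] at hk
      rw [Function.update_of_ne hk.1]
    · refine prod_congr rfl fun e _ => ?_
      split_ifs with h
      · exact hsu _ _ _ _ h.2
      · rfl
  have hfj : ∀ x u, f (Function.update x j u) = f x := by
    intro x u
    simp only [hf]
    rw [Function.update_of_ne hne]
    congr 1
    refine prod_congr rfl fun e he => ?_
    split_ifs with h
    · exact hsu _ _ _ _ fun h2 => hboth e he ⟨h, h2⟩
    · rfl
  have hgi : ∀ x u, g (Function.update x i u) = g x := by
    intro x u
    simp only [hg]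
    rw [Function.update_of_ne hne.symm]
    congr 1
    refine prod_congr rfl fun e he => ?_
    split_ifs with h
    · exact hsu _ _ _ _ fun h2 => hboth e he ⟨h2, h⟩
    · rfl
  have hR0 : ∀ x, 0 ≤ R x := fun x => mul_nonneg (prod_nonneg fun k _ => ind_nonneg _ _)
    (prod_nonneg fun e _ => by split_ifs; exacts [hs0 _ _, zero_le_one])
  have gen : ∀ (k : Fin n) (x : Fin n → V), (E.filter fun e => tch e k).card ≤ t →
      0 ≤ ind A (x k) * ∏ e ∈ E, (if tch e k then s e x else 1) ∧
      ind A (x k) * ∏ e ∈ E, (if tch e k then s e x else 1) ≤ q ^ t := by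
    intro k x hk
    rw [← prod_filter]
    have h0 : 0 ≤ ∏ e ∈ E with tch e k, s e x := prod_nonneg fun e _ => hs0 _ _
    refine ⟨mul_nonneg (ind_nonneg _ _) h0, ?_⟩
    have h1 : ∏ e ∈ E with tch e k, s e x ≤ q ^ t := by
      refine (prod_le_prod (fun e _ => hs0 _ _) (fun e _ => hσq _ _ _)).trans ?_
      rw [prod_const]
      exact pow_le_pow_right₀ hq hk
    calc _ ≤ 1 * ∏ e ∈ E with tch e k, s e x := mul_le_mul_of_nonneg_right (ind_le _ _) h0
      _ ≤ _ := by rw [one_mul]; exact h1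
  have hf2 : ∀ x, f x ^ 2 ≤ q ^ t * f x := by
    intro x
    have := gen i x hti
    change 0 ≤ f x ∧ f x ≤ q ^ t at this
    nlinarith
  have hg2 : ∀ x, g x ^ 2 ≤ q ^ t * g x := by
    intro x
    have := gen j x htj
    change 0 ≤ g x ∧ g x ≤ q ^ t at this
    nlinarith
  set N : ℝ := (Fintype.card V : ℝ) with hN
  -- difference
  have hdiff : ∑ x, Wt A σ (insert (i, j) E) x - ∑ x, Wt A σ E x =
      ∑ x, R x * f x * g x * (σ (i, j) (x i) (x j) - 1) := by
    rw [← sum_sub_distrib]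
    refine sum_congr rfl fun x _ => ?_
    rw [← hW]
    unfold Wt
    rw [prod_insert hE]
    ring
  set Δ := ∑ x, R x * f x * g x * (σ (i, j) (x i) (x j) - 1) with hΔ
  have hN2 : N * (N * Δ) = ∑ x, R x * ∑ u, ∑ v, f (Function.update x i u) * g (Function.update x j v) * (σ (i, j) u v - 1) := by
    rw [hΔ, ← sum_update_avg j, ← sum_update_avg i]
    refine sum_congr rfl fun x _ => ?_
    rw [mul_sum]
    refine sum_congr rfl fun u _ => ?_
    rw [mul_sum]
    refine sum_congr rfl fun v _ => ?_
    rw [hRj, hRi, hfj]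
    rw [Function.update_self, Function.update_of_ne hne, Function.update_self, Function.update_comm hne, hgi]
    ring
  set P := q ^ t * B with hP
  have hsumf : ∑ x, R x * ∑ u, f (Function.update x i u) = N * ∑ x, R x * f x := by
    rw [hN, ← sum_update_avg i]
    refine sum_congr rfl fun x _ => ?_
    rw [mul_sum]
    refine sum_congr rfl fun u _ => ?_
    rw [hRi]
  have hsumg : ∑ x, R x * ∑ u, g (Function.update x j u) = N * ∑ x, R x * g x := by
    rw [hN, ← sum_update_avg j]
    refine sum_congr rfl fun x _ => ?_
    rw [mul_sum]
    refine sum_congr rfl fun u _ => ?_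
    rw [hRj]
  have hb : N * (N * |Δ|) ≤ P * (N * ∑ x, R x * f x + N * ∑ x, R x * g x) := by
    have hN0 : 0 ≤ N := Nat.cast_nonneg _
    have : N * (N * |Δ|) = |N * (N * Δ)| := by rw [abs_mul, abs_mul, abs_of_nonneg hN0]
    rw [this, hN2, ← hsumf, ← hsumg, ← sum_add_distrib, mul_sum]
    refine (abs_sum_le_sum_abs _ _).trans (sum_le_sum fun x _ => ?_)
    rw [abs_mul, abs_of_nonneg (hR0 x)]
    have h1 := hB (fun u => f (Function.update x i u)) (fun v => g (Function.update x j v))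
    have h2 : ∑ u, f (Function.update x i u) ^ 2 ≤ q ^ t * ∑ u, f (Function.update x i u) := by
      rw [mul_sum]; exact sum_le_sum fun u _ => hf2 _
    have h3 : ∑ u, g (Function.update x j u) ^ 2 ≤ q ^ t * ∑ u, g (Function.update x j u) := by
      rw [mul_sum]; exact sum_le_sum fun u _ => hg2 _
    have h4 := h1.trans (mul_le_mul_of_nonneg_left (add_le_add h2 h3) hB0.le)
    have h5 := mul_le_mul_of_nonneg_left h4 (hR0 x)
    refine h5.trans (le_of_eq ?_)
    rw [hP]; ring
  have hA : ∑ v, ind A v = (A.card : ℝ) := by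
    simp [ind]
  have hTj : N * ∑ x, Wt A σ (E.filter fun e => ¬ tch e j) x = A.card * ∑ x, R x * f x := by
    rw [hN, ← sum_update_avg j, mul_sum]
    refine sum_congr rfl fun x _ => ?_
    simp only [hWj, hRj, hfj, Function.update_self]
    rw [← mul_sum, hA]
    ring
  have hTi : N * ∑ x, Wt A σ (E.filter fun e => ¬ tch e i) x = A.card * ∑ x, R x * g x := by
    rw [hN, ← sum_update_avg i, mul_sum]
    refine sum_congr rfl fun x _ => ?_
    simp only [hWi, hRi, hgi, Function.update_self]
    rw [← mul_sum, hA]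
    ring
  rw [hdiff]
  rcases isEmpty_or_nonempty V with hV | hV
  · have : A.card = 0 := by rw [card_eq_zero]; exact Finset.eq_empty_of_isEmpty A
    rw [this]
    have hpos : ∀ E', 0 ≤ ∑ x, Wt A σ E' x := fun E' => sum_nonneg fun x _ =>
      mul_nonneg (prod_nonneg fun k _ => ind_nonneg _ _) (prod_nonneg fun e _ => hσ0 _ _ _)
    have hP0 : 0 ≤ P := by positivity
    have := mul_nonneg hP0 (add_nonneg (hpos (E.filter fun e => ¬ tch e j)) (hpos (E.filter fun e => ¬ tch e i)))
    simpa using this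
  have hNpos : 0 < N := by rw [hN]; exact_mod_cast Fintype.card_pos
  have hfin := mul_le_mul_of_nonneg_left hb (Nat.cast_nonneg A.card : (0 : ℝ) ≤ A.card)
  have : (N * N) * ((A.card : ℝ) * |Δ|) ≤ (N * N) * (P * (∑ x, Wt A σ (E.filter fun e => ¬ tch e j) x + ∑ x, Wt A σ (E.filter fun e => ¬ tch e i) x)) := by
    calc (N * N) * ((A.card : ℝ) * |Δ|) = A.card * (N * (N * |Δ|)) := by ring
      _ ≤ _ := hfin
      _ = N * P * (A.card * ∑ x, R x * f x + A.card * ∑ x, R x * g x) := by ring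
      _ = _ := by rw [← hTj, ← hTi]; ring
  exact le_of_mul_le_mul_left this (by positivity)

theorem comb (hn : 0 < n) (A : Finset V) (σ : Fin n × Fin n → V → V → ℝ) (q : ℝ) (hq : 1 ≤ q)
    (hσ0 : ∀ e u v, 0 ≤ σ e u v) (hσq : ∀ e u v, σ e u v ≤ q) (B : ℝ) (hB0 : 0 < B)
    (E0 : Finset (Fin n × Fin n)) (hlt : ∀ e ∈ E0, e.1 < e.2)
    (hB : ∀ e ∈ E0, ∀ f g : V → ℝ, |∑ u, ∑ v, f u * g v * (σ e u v - 1)| ≤ B * (∑ u, f u ^ 2 + ∑ v, g v ^ 2))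
    (t : ℕ) (hdeg : ∀ i, (E0.filter fun e => tch e i).card ≤ t + 1)
    (hA : 4 * (E0.card : ℝ) * (q ^ t * B) ≤ A.card) :
    ∀ c : ℕ, ∀ E ⊆ E0, E.card = c → |∑ x, Wt A σ E x - (A.card : ℝ) ^ n| ≤ 4 * c * (q ^ t * B) * (A.card : ℝ) ^ (n - 1) := by
  intro c
  induction c using Nat.strong_induction_on with
  | _ c ih =>
  intro E hE hc
  have hP : 0 < q ^ t * B := by positivity
  set P := q ^ t * B with hPd
  rcases E.eq_empty_or_nonempty with rfl | ⟨⟨i, j⟩, he⟩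
  · have h0 : ∑ x : Fin n → V, Wt A σ ∅ x = (A.card : ℝ) ^ n := by
      unfold Wt
      simp only [prod_empty, mul_one]
      have := (Finset.prod_univ_sum (fun _ : Fin n => (univ : Finset V)) (fun _ v => ind A v)).symm
      rw [Fintype.piFinset_univ] at this
      rw [this]
      simp [ind]
    rw [h0, sub_self, abs_zero]
    positivity
  · have he0 := hE he
    have hij : i < j := hlt _ he0
    set E' := E.erase (i, j) with hE'
    have hsub : E' ⊆ E0 := (erase_subset _ _).trans hE
    have hc1 : E'.card + 1 = c := by rw [hE', card_erase_add_one he, hc]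
    have hins : insert (i, j) E' = E := insert_erase he
    have hnot : (i, j) ∉ E' := notMem_erase _ _
    have hcardE : c ≤ E0.card := hc ▸ card_le_card hE
    have hdeg' : ∀ k, tch (i, j) k → (E'.filter fun e => tch e k).card ≤ t := by
      intro k hk
      have h1 := hdeg k
      have h2 : insert (i, j) (E'.filter fun e => tch e k) ⊆ E0.filter fun e => tch e k := by
        intro e h
        rw [mem_insert] at h
        rcases h with rfl | h
        · exact mem_filter.2 ⟨he0, hk⟩
        · rw [mem_filter] at h ⊢
          exact ⟨hsub h.1, h.2⟩
      have h3 := card_le_card h2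
      rw [card_insert_of_notMem (fun h => hnot (mem_filter.1 h).1)] at h3
      omega
    have hstep := step_bound A σ q hq hσ0 hσq B hB0 E' (fun e h => hlt e (hsub h)) i j hij hnot (hB _ he0) t
      (hdeg' i (Or.inl rfl)) (hdeg' j (Or.inr rfl))
    rw [hins, ← hPd] at hstep
    have hcpos : 1 ≤ E0.card := by omega
    have hapos : (0 : ℝ) < A.card := by
      have : (1 : ℝ) ≤ E0.card := by exact_mod_cast hcpos
      nlinarith
    set a : ℝ := (A.card : ℝ) with ha
    have hpow : a ^ n = a * a ^ (n - 1) := by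
      rw [← pow_succ', Nat.sub_add_cancel hn]
    have hap : 0 < a ^ (n - 1) := by positivity
    have hsmall : ∀ E'' ⊆ E', ∑ x, Wt A σ E'' x ≤ 2 * a ^ n := by
      intro E'' h
      have hle := card_le_card h
      have h1 := ih E''.card (by omega) E'' (h.trans hsub) rfl
      have h2 := (abs_le.1 h1).2
      have h3 : (E''.card : ℝ) ≤ E0.card := by exact_mod_cast (by omega : E''.card ≤ E0.card)
      have h4 : 4 * (E''.card : ℝ) * P ≤ a := by nlinarith
      have h5 := mul_le_mul_of_nonneg_right h4 hap.le
      rw [hpow] at h2 ⊢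
      linarith
    have hs1 := hsmall (E'.filter fun e => ¬ tch e j) (filter_subset _ _)
    have hs2 := hsmall (E'.filter fun e => ¬ tch e i) (filter_subset _ _)
    have h6 : a * |∑ x, Wt A σ E x - ∑ x, Wt A σ E' x| ≤ a * (4 * P * a ^ (n - 1)) := by
      refine hstep.trans ?_
      have := mul_le_mul_of_nonneg_left (add_le_add hs1 hs2) hP.le
      rw [hpow] at this
      linarith
    have h7 := le_of_mul_le_mul_left h6 hapos
    have h8 := ih E'.card (by omega) E' hsub rfl
    have h9 : (c : ℝ) = E'.card + 1 := by exact_mod_cast hc1.symm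
    have h10 := abs_sub_le (∑ x, Wt A σ E x) (∑ x, Wt A σ E' x) (a ^ n)
    rw [h9]
    linarith

end Comb

/-- Asymptotic count of isometric copies of a distance graph,
quadratic form case. -/
theorem stmt6 (q d n m t : ℕ) (hd : 2 ≤ d) (hn : 0 < n)
    (F : Type) [Field F] [Fintype F] [DecidableEq F]
    (hq : Fintype.card F = q) (hodd : Odd q)
    (Q : QuadraticForm F (Fin d → F))
    (hQ : ∀ x, (∀ y, QuadraticMap.polar (⇑Q) x y = 0) → x = 0)
    (G : SimpleGraph (Fin n)) [DecidableRel G.Adj]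
    (hm : G.edgeFinset.card = m)
    (hdeg : ∀ v, G.degree v ≤ t)
    (lam : Fin n → Fin n → F)
    (hsymm : ∀ i j, lam i j = lam j i)
    (hlam : ∀ i j, G.Adj i j → lam i j ≠ 0)
    (A : Finset (Fin d → F)) (α : ℝ)
    (hcard : (A.card : ℝ) = α * (q : ℝ) ^ d)
    (hα : α ≥ 4 * (m : ℝ) * (q : ℝ) ^ ((t : ℝ) - ((d : ℝ) + 1) / 2)) :
    |(q : ℝ) ^ (-((n : ℝ) * (d : ℝ))) *
        (∑ x : Fin n → (Fin d → F),
          (∏ i, if x i ∈ A then (1 : ℝ) else 0) *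
            ∏ i, ∏ j, if i < j ∧ G.Adj i j then
              (if Q (x i - x j) = lam i j then (q : ℝ) else 0) else 1) -
        α ^ n| ≤
      4 * (m : ℝ) * α ^ (n - 1) * (q : ℝ) ^ ((t : ℝ) - ((d : ℝ) + 1) / 2) := by
  classical
  subst hq
  set q := Fintype.card F with hqd
  have hq1 : 1 < q := Fintype.one_lt_card
  have hqr : (1 : ℝ) ≤ q := by exact_mod_cast hq1.le
  have hq0 : (0 : ℝ) < q := by linarith
  set σ : Fin n × Fin n → (Fin d → F) → (Fin d → F) → ℝ :=
    fun e u v => if Q (u - v) = lam e.1 e.2 then (q : ℝ) else 0 with hσ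
  set E0 : Finset (Fin n × Fin n) := univ.filter fun p => p.1 < p.2 ∧ G.Adj p.1 p.2 with hE0
  set B : ℝ := Real.sqrt q ^ (d + 1) with hBd
  have hB0 : 0 < B := pow_pos (Real.sqrt_pos.2 hq0) _
  have hE0m : E0.card ≤ m := by
    rw [← hm]
    refine card_le_card_of_injOn (fun p => s(p.1, p.2)) ?_ ?_
    · intro p hp
      have hp' := (mem_filter.1 hp).2
      simpa using hp'.2
    · intro p hp r hr h
      have hp' := (mem_filter.1 hp).2.1
      have hr' := (mem_filter.1 hr).2.1
      rcases Sym2.eq_iff.1 h with h | h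
      · exact Prod.ext h.1 h.2
      · rw [h.1, h.2] at hp'
        exact absurd hp' hr'.asymm
  have hdegE : ∀ i, (E0.filter fun e => tch e i).card ≤ t := by
    intro i
    refine le_trans ?_ (hdeg i)
    rw [← SimpleGraph.card_neighborFinset_eq_degree]
    refine card_le_card_of_injOn (fun p => if p.1 = i then p.2 else p.1) ?_ ?_
    · intro p hp
      obtain ⟨hp1, hp2⟩ := mem_filter.1 hp
      have hp3 := (mem_filter.1 hp1).2
      simp only [SimpleGraph.coe_neighborFinset, SimpleGraph.mem_neighborSet]
      split_ifs with h
      · rw [← h]; exact hp3.2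
      · rcases hp2 with h2 | h2
        · exact absurd h2 h
        · rw [← h2]; exact hp3.2.symm
    · intro p hp r hr h
      obtain ⟨hp1, hp2⟩ := mem_filter.1 hp
      obtain ⟨hr1, hr2⟩ := mem_filter.1 hr
      have hp3 := (mem_filter.1 hp1).2.1
      have hr3 := (mem_filter.1 hr1).2.1
      simp only at h
      split_ifs at h with h1 h2 h2
      · exact Prod.ext (h1.trans h2.symm) h
      · have h4 := hr2.resolve_left h2
        rw [h1, h] at hp3
        rw [h4] at hr3
        exact absurd hp3 hr3.asymm
      · have h4 := hp2.resolve_left h1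
        rw [h4, h] at hp3
        rw [h2] at hr3
        exact absurd hp3 hr3.asymm
      · exact Prod.ext h ((hp2.resolve_left h1).trans (hr2.resolve_left h2).symm)
  have hS : ∀ x : Fin n → (Fin d → F), ((∏ i, if x i ∈ A then (1 : ℝ) else 0) *
            ∏ i, ∏ j, if i < j ∧ G.Adj i j then
              (if Q (x i - x j) = lam i j then (q : ℝ) else 0) else 1) = Wt A σ E0 x := by
    intro x
    unfold Wt ind
    congr 1
    rw [hE0, prod_filter, Fintype.prod_prod_type]
  simp only [hS]
  set ε : ℝ := (q : ℝ) ^ ((t : ℝ) - ((d : ℝ) + 1) / 2) with hε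
  have hε0 : 0 < ε := Real.rpow_pos_of_pos hq0 _
  have hPε : E0.Nonempty → (q : ℝ) ^ (t - 1) * B = ε * (q : ℝ) ^ d := by
    rintro ⟨e, he⟩
    have ht : 1 ≤ t := by
      refine le_trans ?_ (hdegE e.1)
      rw [Nat.one_le_iff_ne_zero, Ne, card_eq_zero]
      exact Finset.ne_empty_of_mem (mem_filter.2 ⟨he, Or.inl rfl⟩)
    rw [hBd, Real.sqrt_eq_rpow, ← Real.rpow_natCast, ← Real.rpow_natCast, ← Real.rpow_natCast, ← Real.rpow_mul hq0.le,
      ← Real.rpow_add hq0, hε, ← Real.rpow_add hq0]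
    congr 1
    push_cast [Nat.cast_sub ht]
    ring
  have hα0 : 0 ≤ α := le_trans (by positivity) hα
  have hqd0 : (0 : ℝ) < (q : ℝ) ^ d := pow_pos hq0 d
  have hmr : (E0.card : ℝ) ≤ m := by exact_mod_cast hE0m
  have hA : 4 * (E0.card : ℝ) * ((q : ℝ) ^ (t - 1) * B) ≤ A.card := by
    rcases E0.eq_empty_or_nonempty with h | h
    · rw [h]; simp
    · rw [hPε h, hcard]
      have h1 : 4 * (E0.card : ℝ) * ε ≤ α := by
        refine le_trans ?_ hα
        exact mul_le_mul_of_nonneg_right (by linarith) hε0.le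
      have := mul_le_mul_of_nonneg_right h1 hqd0.le
      linarith
  have main := comb hn A σ (q : ℝ) hqr
    (fun e u v => by simp only [hσ]; split_ifs <;> linarith)
    (fun e u v => by simp only [hσ]; split_ifs <;> linarith) B hB0 E0
    (fun e he => (mem_filter.1 he).2.1)
    (fun e he f g => spectral hodd Q hQ (lam e.1 e.2) (hlam _ _ (mem_filter.1 he).2.2) f g)
    (t - 1) (fun i => (hdegE i).trans (by omega)) hA E0.card E0 (Subset.refl _) rfl
  set S := ∑ x, Wt A σ E0 x with hSd
  have hbound : |S - (A.card : ℝ) ^ n| ≤ 4 * m * (ε * (q : ℝ) ^ d) * (A.card : ℝ) ^ (n - 1) := by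
    refine main.trans ?_
    rcases E0.eq_empty_or_nonempty with h | h
    · rw [h]
      simp only [card_empty, Nat.cast_zero, mul_zero, zero_mul]
      positivity
    · rw [hPε h]
      gcongr
  have hneg : (q : ℝ) ^ (-((n : ℝ) * (d : ℝ))) = (((q : ℝ) ^ d) ^ n)⁻¹ := by
    rw [Real.rpow_neg hq0.le, ← pow_mul, ← Real.rpow_natCast]
    push_cast
    rw [mul_comm]
  have hne : ((q : ℝ) ^ d) ^ n ≠ 0 := by positivity
  have heq : (q : ℝ) ^ (-((n : ℝ) * (d : ℝ))) * S - α ^ n = (((q : ℝ) ^ d) ^ n)⁻¹ * (S - (A.card : ℝ) ^ n) := by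
    rw [hneg, hcard, mul_pow]
    field_simp
  rw [heq, abs_mul, abs_of_nonneg (by positivity)]
  refine (mul_le_mul_of_nonneg_left hbound (by positivity)).trans (le_of_eq ?_)
  rw [hcard]
  obtain ⟨k, rfl⟩ : ∃ k, n = k + 1 := ⟨n - 1, by omega⟩
  rw [Nat.add_sub_cancel, mul_pow, pow_succ ((q : ℝ) ^ d)]
  field_simp
end
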